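/- Let B denote the three-dimensional commutative local ℂ-algebra ℂ[a,b]/(a², ab, b²). The center Z of g_{p₊,p₋} is isomorphic, as a ℂ-algebra, to the direct product ℂ × ℂ × B^{p₊−1} × B^{p₋−1} × (B ⊗_ℂ B)^{(p₊−1)(p₋−1)/2}: two one-dimensional blocks, p₊−1 plus p₋−1 blocks isomorphic to B, and (p₊−1)(p₋−1)/2 blocks isomorphic to B ⊗_ℂ B. -/

import Mathlib

noncomputable section

open scoped TensorProduct

/-- Generators of the quantum group `g_{p₊,p₋}`. -/
inductive QGGen : Type
  | Ep | Fp | Em | Fm | K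

open FreeAlgebra QGGen

/-- `q = exp(iπ/p)`. -/
def rootOfUnity (p : ℕ) : ℂ := Complex.exp (Real.pi * Complex.I / p)

/-- The defining relations of the quantum group `g_{p₊,p₋}`. -/
inductive QGRel (pp pm : ℕ) : FreeAlgebra ℂ QGGen → FreeAlgebra ℂ QGGen → Prop
  | EpNil : QGRel pp pm (ι ℂ Ep ^ pp) 0
  | FpNil : QGRel pp pm (ι ℂ Fp ^ pp) 0
  | EmNil : QGRel pp pm (ι ℂ Em ^ pm) 0
  | FmNil : QGRel pp pm (ι ℂ Fm ^ pm) 0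
  | KOrd : QGRel pp pm (ι ℂ K ^ (2 * pp * pm)) 1
  | KEp : QGRel pp pm (ι ℂ K * ι ℂ Ep)
      (algebraMap ℂ (FreeAlgebra ℂ QGGen) ((rootOfUnity pp) ^ 2) * (ι ℂ Ep * ι ℂ K))
  | KFp : QGRel pp pm (ι ℂ K * ι ℂ Fp)
      (algebraMap ℂ (FreeAlgebra ℂ QGGen) (((rootOfUnity pp) ^ 2)⁻¹) * (ι ℂ Fp * ι ℂ K))
  | KEm : QGRel pp pm (ι ℂ K * ι ℂ Em)
      (algebraMap ℂ (FreeAlgebra ℂ QGGen) ((rootOfUnity pm) ^ 2) * (ι ℂ Em * ι ℂ K))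
  | KFm : QGRel pp pm (ι ℂ K * ι ℂ Fm)
      (algebraMap ℂ (FreeAlgebra ℂ QGGen) (((rootOfUnity pm) ^ 2)⁻¹) * (ι ℂ Fm * ι ℂ K))
  | EpEm : QGRel pp pm (ι ℂ Ep * ι ℂ Em) (ι ℂ Em * ι ℂ Ep)
  | FpFm : QGRel pp pm (ι ℂ Fp * ι ℂ Fm) (ι ℂ Fm * ι ℂ Fp)
  | EpFm : QGRel pp pm (ι ℂ Ep * ι ℂ Fm) (ι ℂ Fm * ι ℂ Ep)
  | EmFp : QGRel pp pm (ι ℂ Em * ι ℂ Fp) (ι ℂ Fp * ι ℂ Em)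
  | EpFp : QGRel pp pm (ι ℂ Ep * ι ℂ Fp - ι ℂ Fp * ι ℂ Ep)
      (algebraMap ℂ (FreeAlgebra ℂ QGGen)
          (((rootOfUnity pp) ^ pm - ((rootOfUnity pp) ^ pm)⁻¹)⁻¹) *
        (ι ℂ K ^ pm - ι ℂ K ^ (2 * pp * pm - pm)))
  | EmFm : QGRel pp pm (ι ℂ Em * ι ℂ Fm - ι ℂ Fm * ι ℂ Em)
      (algebraMap ℂ (FreeAlgebra ℂ QGGen)
          (((rootOfUnity pm) ^ pp - ((rootOfUnity pm) ^ pp)⁻¹)⁻¹) *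
        (ι ℂ K ^ pp - ι ℂ K ^ (2 * pp * pm - pp)))

/-- The quantum group `g_{p₊,p₋}`. -/
abbrev QG (pp pm : ℕ) : Type := RingQuot (QGRel pp pm)

/-- The three-dimensional commutative local algebra `B = ℂ[a,b]/(a², ab, b²)`. -/
abbrev LocalB : Type :=
  MvPolynomial (Fin 2) ℂ ⧸
    Ideal.span ({MvPolynomial.X 0 ^ 2, MvPolynomial.X 0 * MvPolynomial.X 1,
      MvPolynomial.X 1 ^ 2} : Set (MvPolynomial (Fin 2) ℂ))

section CyclicAlgebras

open Polynomial

/-- Elements `E`, `F`, `e i` of an algebra subject to the relations of a weight-graded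
generalized Weyl algebra whose weights form a cycle of length `p`. -/
structure CyclicRel {p : ℕ} [NeZero p] (lam : ZMod p → ℂ) {A : Type*} [Ring A] [Algebra ℂ A]
    (E F : A) (e : ZMod p → A) : Prop where
  e_mul_e : ∀ i j, e i * e j = if i = j then e i else 0
  sum_e : ∑ i, e i = 1
  E_mul_e : ∀ i, E * e i = e (i + 1) * E
  F_mul_e : ∀ i, F * e (i + 1) = e i * F
  comm : E * F - F * E = ∑ i, (lam i - lam (i - 1)) • e i

namespace CyclicRel

variable {p : ℕ} [NeZero p] {lam : ZMod p → ℂ} {A : Type*} [Ring A] [Algebra ℂ A]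
  {E F : A} {e : ZMod p → A}

lemma ext_mul_e (h : CyclicRel lam E F e) {x y : A} (hxy : ∀ i, x * e i = y * e i) : x = y := by
  rw [← mul_one x, ← mul_one y, ← h.sum_e, Finset.mul_sum, Finset.mul_sum]
  exact Finset.sum_congr rfl fun i _ => hxy i

lemma sum_smul_mul_e (h : CyclicRel lam E F e) (c : ZMod p → ℂ) (i : ZMod p) :
    (∑ j, c j • e j) * e i = c i • e i := by
  simp [Finset.sum_mul, h.e_mul_e]

lemma e_mul_sum_smul (h : CyclicRel lam E F e) (c : ZMod p → ℂ) (i : ZMod p) :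
    e i * (∑ j, c j • e j) = c i • e i := by
  simp [Finset.mul_sum, h.e_mul_e]

lemma F_mul_e' (h : CyclicRel lam E F e) (i : ZMod p) : F * e i = e (i - 1) * F := by
  simpa using h.F_mul_e (i - 1)

lemma E_pow_mul_e (h : CyclicRel lam E F e) (n : ℕ) (i : ZMod p) :
    E ^ n * e i = e (i + n) * E ^ n := by
  induction n with
  | zero => simp
  | succ n ih =>
    rw [pow_succ', mul_assoc, ih, ← mul_assoc, h.E_mul_e, mul_assoc, Nat.cast_succ, add_assoc]

lemma F_pow_mul_e (h : CyclicRel lam E F e) (n : ℕ) (i : ZMod p) :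
    F ^ n * e i = e (i - n) * F ^ n := by
  induction n with
  | zero => simp
  | succ n ih =>
    rw [pow_succ', mul_assoc, ih, ← mul_assoc, h.F_mul_e', mul_assoc, Nat.cast_succ, sub_sub]

/-- The Casimir element. -/
def casimir (lam : ZMod p → ℂ) (E F : A) (e : ZMod p → A) : A := F * E + ∑ i, lam i • e i

local notation "Ω" => casimir lam E F e

lemma FE_mul_e (h : CyclicRel lam E F e) (i : ZMod p) :
    F * E * e i = Ω * e i - lam i • e i := by
  rw [casimir, add_mul, h.sum_smul_mul_e]; simp

lemma EF_mul_e (h : CyclicRel lam E F e) (i : ZMod p) :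
    E * F * e i = Ω * e i - lam (i - 1) • e i := by
  have := congrArg (· * e i) h.comm
  simp only [sub_mul, h.sum_smul_mul_e, h.FE_mul_e] at this
  rw [sub_eq_iff_eq_add] at this
  rw [this, sub_smul]; abel

lemma casimir_e (h : CyclicRel lam E F e) (i : ZMod p) : Commute Ω (e i) := by
  have h1 : Commute (F * E) (e i) := by
    rw [Commute, SemiconjBy, mul_assoc, h.E_mul_e, ← mul_assoc, h.F_mul_e, mul_assoc]
  refine h1.add_left ?_
  rw [Commute, SemiconjBy, h.sum_smul_mul_e, h.e_mul_sum_smul]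

lemma casimir_E (h : CyclicRel lam E F e) : Commute Ω E := by
  refine h.ext_mul_e fun i => ?_
  rw [mul_assoc, h.E_mul_e, ← mul_assoc,
    sub_eq_iff_eq_add.1 (h.EF_mul_e (i + 1)).symm, mul_assoc E Ω,
    sub_eq_iff_eq_add.1 (h.FE_mul_e i).symm]
  rw [add_mul, mul_add, mul_assoc, ← h.E_mul_e]
  simp [mul_assoc, h.E_mul_e]

lemma casimir_F (h : CyclicRel lam E F e) : Commute Ω F := by
  refine h.ext_mul_e fun i => ?_
  rw [mul_assoc, h.F_mul_e', ← mul_assoc,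
    sub_eq_iff_eq_add.1 (h.FE_mul_e (i - 1)).symm, mul_assoc F Ω,
    sub_eq_iff_eq_add.1 (h.EF_mul_e i).symm]
  rw [add_mul, mul_add, mul_assoc, ← h.F_mul_e']
  simp [mul_assoc, h.F_mul_e']

lemma aeval_casimir_commute {x : A} (h : Commute Ω x) (g : ℂ[X]) : Commute (aeval Ω g) x := by
  induction g using Polynomial.induction_on' with
  | add g k hg hk => rw [map_add]; exact hg.add_left hk
  | monomial n c =>
    rw [aeval_monomial]
    exact (show Commute _ x from Algebra.commutes c x).mul_left (h.pow_left n)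

lemma F_pow_mul_E_pow_mul_e (h : CyclicRel lam E F e) (n : ℕ) (i : ZMod p) :
    F ^ n * E ^ n * e i
      = aeval Ω (∏ j ∈ Finset.range n, (X - C (lam (i + j)))) * e i := by
  induction n with
  | zero => simp
  | succ n ih =>
    calc F ^ (n + 1) * E ^ (n + 1) * e i = F ^ n * (F * E * (E ^ n * e i)) := by
          rw [pow_succ F, pow_succ' E]; simp only [mul_assoc]
      _ = F ^ n * ((Ω - algebraMap ℂ A (lam (i + n))) * (E ^ n * e i)) := by
          rw [h.E_pow_mul_e, ← mul_assoc (F * E), h.FE_mul_e, Algebra.smul_def, ← sub_mul,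
            mul_assoc (Ω - _)]
      _ = (Ω - algebraMap ℂ A (lam (i + n))) * (F ^ n * E ^ n * e i) := by
          have : Commute (Ω - algebraMap ℂ A (lam (i + n))) (F ^ n) :=
            (h.casimir_F.pow_right n).sub_left (Algebra.commutes _ _)
          rw [← mul_assoc, ← this.eq]; simp only [mul_assoc]
      _ = _ := by
          rw [ih, Finset.prod_range_succ, mul_comm (∏ j ∈ _, _), map_mul, mul_assoc]; simp

lemma E_pow_mul_F_pow_mul_e (h : CyclicRel lam E F e) (n : ℕ) (i : ZMod p) :
    E ^ n * F ^ n * e i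
      = aeval Ω (∏ j ∈ Finset.range n, (X - C (lam (i - 1 - j)))) * e i := by
  induction n with
  | zero => simp
  | succ n ih =>
    calc E ^ (n + 1) * F ^ (n + 1) * e i = E ^ n * (E * F * (F ^ n * e i)) := by
          rw [pow_succ E, pow_succ' F]; simp only [mul_assoc]
      _ = E ^ n * ((Ω - algebraMap ℂ A (lam (i - 1 - n))) * (F ^ n * e i)) := by
          rw [h.F_pow_mul_e, ← mul_assoc (E * F), h.EF_mul_e, Algebra.smul_def, ← sub_mul,
            mul_assoc (Ω - _), sub_right_comm]
      _ = (Ω - algebraMap ℂ A (lam (i - 1 - n))) * (E ^ n * F ^ n * e i) := by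
          have : Commute (Ω - algebraMap ℂ A (lam (i - 1 - n))) (E ^ n) :=
            (h.casimir_E.pow_right n).sub_left (Algebra.commutes _ _)
          rw [← mul_assoc, ← this.eq]; simp only [mul_assoc]
      _ = _ := by
          rw [ih, Finset.prod_range_succ, mul_comm (∏ j ∈ _, _), map_mul, mul_assoc]; simp

lemma E_pow_commute_F (h : CyclicRel lam E F e) : Commute (E ^ p) F := by
  refine h.ext_mul_e fun i => ?_
  obtain ⟨n, hn⟩ : ∃ n, p = n + 1 := Nat.exists_eq_succ_of_ne_zero (NeZero.ne p)
  have hi : i + (n : ZMod p) = i - 1 := by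
    have : ((n + 1 : ℕ) : ZMod p) = 0 := by rw [← hn]; simp
    push_cast at this
    linear_combination this
  have h1 : E ^ p = E ^ n * E := by rw [← pow_succ, ← hn]
  have h2 : E ^ p = E * E ^ n := by rw [← pow_succ', ← hn]
  calc E ^ p * F * e i = E ^ n * (E * F * e i) := by rw [h1]; simp only [mul_assoc]
    _ = (Ω - algebraMap ℂ A (lam (i - 1))) * (E ^ n * e i) := by
      have : Commute (Ω - algebraMap ℂ A (lam (i - 1))) (E ^ n) :=
        (h.casimir_E.pow_right n).sub_left (Algebra.commutes _ _)
      rw [h.EF_mul_e, Algebra.smul_def, ← sub_mul, ← mul_assoc, ← this.eq, mul_assoc]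
    _ = F * E ^ p * e i := by
      rw [h.E_pow_mul_e, hi, h2, ← mul_assoc, sub_mul, ← Algebra.smul_def, ← h.FE_mul_e,
        mul_assoc, ← hi, ← h.E_pow_mul_e]
      simp only [mul_assoc]

lemma E_mul_F_pow_mul_e (h : CyclicRel lam E F e) (n : ℕ) (i : ZMod p) :
    E * F ^ (n + 1) * e i
      = F ^ (n + 1) * E * e i + (lam i - lam (i - (n + 1))) • (F ^ n * e i) := by
  have h1 : E * F ^ (n + 1) * e i = Ω * (F ^ n * e i) - lam (i - n - 1) • (F ^ n * e i) := by
    rw [pow_succ', ← mul_assoc, mul_assoc _ (F ^ n), h.F_pow_mul_e, ← mul_assoc, h.EF_mul_e,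
      sub_mul, smul_mul_assoc, mul_assoc]
  have h2 : F ^ (n + 1) * E * e i = Ω * (F ^ n * e i) - lam i • (F ^ n * e i) := by
    rw [pow_succ, mul_assoc (F ^ n), mul_assoc (F ^ n), h.FE_mul_e, mul_sub, mul_smul_comm,
      ← mul_assoc, ← mul_assoc, (h.casimir_F.pow_right n).eq]
  rw [h1, h2, sub_smul, sub_sub]
  abel

end CyclicRel

/-- The relations `CyclicRel` together with nilpotency of `E` and `F` and the
Poincaré–Birkhoff–Witt property. -/
structure CyclicBasis {p : ℕ} [NeZero p] (lam : ZMod p → ℂ) {A : Type*} [Ring A] [Algebra ℂ A]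
    (E F : A) (e : ZMod p → A) : Prop extends CyclicRel lam E F e where
  E_pow : E ^ p = 0
  F_pow : F ^ p = 0
  linearIndependent : LinearIndependent ℂ
    (fun t : ZMod p × Fin p × Fin p => F ^ (t.2.1 : ℕ) * E ^ (t.2.2 : ℕ) * e t.1)
  span : ⊤ ≤ Submodule.span ℂ
    (Set.range fun t : ZMod p × Fin p × Fin p => F ^ (t.2.1 : ℕ) * E ^ (t.2.2 : ℕ) * e t.1)

lemma Algebra.adjoin_le_span_of_mul_mem {A ι : Type*} [Ring A] [Algebra ℂ A] (s : Set A)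
    (f : ι → A) (h1 : 1 ∈ Submodule.span ℂ (Set.range f))
    (h : ∀ x ∈ s, ∀ i, x * f i ∈ Submodule.span ℂ (Set.range f)) :
    Subalgebra.toSubmodule (Algebra.adjoin ℂ s) ≤ Submodule.span ℂ (Set.range f) := by
  intro x hx
  suffices ∀ y ∈ Submodule.span ℂ (Set.range f), x * y ∈ Submodule.span ℂ (Set.range f) by
    simpa using this 1 h1
  rw [Subalgebra.mem_toSubmodule] at hx
  induction hx using Algebra.adjoin_induction with
  | mem x hx =>
    intro y hy
    induction hy using Submodule.span_induction with
    | mem y hy => obtain ⟨i, rfl⟩ := hy; exact h x hx i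
    | zero => simp
    | add y z _ _ hy hz => rw [mul_add]; exact add_mem hy hz
    | smul c y _ hy => rw [mul_smul_comm]; exact Submodule.smul_mem _ _ hy
  | algebraMap c => intro y hy; rw [← Algebra.smul_def]; exact Submodule.smul_mem _ _ hy
  | add x z _ _ hx hz => intro y hy; rw [add_mul]; exact add_mem (hx y hy) (hz y hy)
  | mul x z _ _ hx hz => intro y hy; rw [mul_assoc]; exact hx _ (hz y hy)

namespace CyclicRel

variable {p : ℕ} [NeZero p] {lam : ZMod p → ℂ} {A : Type*} [Ring A] [Algebra ℂ A]
  {E F : A} {e : ZMod p → A}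

omit [NeZero p] in
lemma monomial_mem_span (hE : E ^ p = 0) (hF : F ^ p = 0) (i j : ℕ) (m : ZMod p) :
    F ^ i * E ^ j * e m ∈ Submodule.span ℂ
      (Set.range fun t : ZMod p × Fin p × Fin p => F ^ (t.2.1 : ℕ) * E ^ (t.2.2 : ℕ) * e t.1) := by
  by_cases hi : i < p
  · by_cases hj : j < p
    · exact Submodule.subset_span ⟨(m, ⟨i, hi⟩, ⟨j, hj⟩), rfl⟩
    · rw [pow_eq_zero_of_le (not_lt.1 hj) hE]; simp
  · rw [pow_eq_zero_of_le (not_lt.1 hi) hF]; simp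

lemma adjoin_le_span (h : CyclicRel lam E F e) (hE : E ^ p = 0) (hF : F ^ p = 0) :
    Subalgebra.toSubmodule (Algebra.adjoin ℂ ({E, F} ∪ Set.range e)) ≤ Submodule.span ℂ
      (Set.range fun t : ZMod p × Fin p × Fin p =>
        F ^ (t.2.1 : ℕ) * E ^ (t.2.2 : ℕ) * e t.1) := by
  have key := monomial_mem_span (e := e) hE hF
  refine Algebra.adjoin_le_span_of_mul_mem _ _ ?_ ?_
  · rw [← h.sum_e]
    exact Submodule.sum_mem _ fun i _ => by simpa using key 0 0 i
  rintro x ((rfl | rfl) | ⟨n, rfl⟩) ⟨m, ⟨i, hi⟩, ⟨j, hj⟩⟩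
  · dsimp only
    rcases i with _ | i
    · simpa [pow_succ', mul_assoc] using key 0 (j + 1) m
    · have : x * (F ^ (i + 1) * x ^ j * e m)
          = F ^ (i + 1) * x ^ (j + 1) * e m
            + (lam (m + j) - lam (m + j - (i + 1))) • (F ^ i * x ^ j * e m) := by
        rw [mul_assoc (F ^ (i + 1)), h.E_pow_mul_e, ← mul_assoc, ← mul_assoc,
          h.E_mul_F_pow_mul_e, add_mul, smul_mul_assoc, mul_assoc (F ^ i), ← h.E_pow_mul_e,
          mul_assoc _ (e _), ← h.E_pow_mul_e]
        simp only [pow_succ', mul_assoc]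
      rw [this]
      exact add_mem (key _ _ _) (Submodule.smul_mem _ _ (key _ _ _))
  · simpa [pow_succ', mul_assoc] using key (i + 1) j m
  · dsimp only
    rw [mul_assoc, h.E_pow_mul_e, ← mul_assoc (F ^ i), h.F_pow_mul_e, mul_assoc, ← mul_assoc,
      h.e_mul_e]
    split_ifs with hn
    · subst hn
      rw [← mul_assoc, ← h.F_pow_mul_e, mul_assoc, ← h.E_pow_mul_e, ← mul_assoc]
      exact key i j m
    · simp

end CyclicRel

namespace CyclicModel

variable {p : ℕ} [NeZero p]

/-- The free module on the ordered monomials. -/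
abbrev Space (p : ℕ) : Type := (ZMod p × Fin p × Fin p) →₀ ℂ

/-- The vector standing for `F ^ i * E ^ j * e m`, which is zero when `i` or `j` is at least
`p`. -/
def vec (m : ZMod p) (i j : ℕ) : Space p :=
  if h : i < p ∧ j < p then Finsupp.single (m, ⟨i, h.1⟩, ⟨j, h.2⟩) 1 else 0

omit [NeZero p] in
lemma vec_eq_single (t : ZMod p × Fin p × Fin p) :
    vec t.1 t.2.1 t.2.2 = Finsupp.single t 1 := by
  simp [vec]

omit [NeZero p] in
lemma vec_of_le_left {m : ZMod p} {i j : ℕ} (h : p ≤ i) : vec m i j = 0 := by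
  rw [vec, dif_neg]; omega

omit [NeZero p] in
lemma vec_of_le_right {m : ZMod p} {i j : ℕ} (h : p ≤ j) : vec m i j = 0 := by
  rw [vec, dif_neg]; omega

/-- Linear endomorphisms determined by their values on the monomials. -/
def lift (f : ZMod p → ℕ → ℕ → Space p) : Module.End ℂ (Space p) :=
  Finsupp.linearCombination ℂ fun t => f t.1 t.2.1 t.2.2

omit [NeZero p] in
lemma lift_vec (f : ZMod p → ℕ → ℕ → Space p) (h1 : ∀ m i j, p ≤ i → f m i j = 0)
    (h2 : ∀ m i j, p ≤ j → f m i j = 0) (m : ZMod p) (i j : ℕ) :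
    lift f (vec m i j) = f m i j := by
  by_cases hi : i < p
  · by_cases hj : j < p
    · simp [vec, hi, hj, lift]
    · rw [vec_of_le_right (not_lt.1 hj), map_zero, h2 _ _ _ (not_lt.1 hj)]
  · rw [vec_of_le_left (not_lt.1 hi), map_zero, h1 _ _ _ (not_lt.1 hi)]

omit [NeZero p] in
lemma end_ext {f g : Module.End ℂ (Space p)} (h : ∀ m i j, f (vec m i j) = g (vec m i j)) :
    f = g := by
  refine Finsupp.lhom_ext' fun t => LinearMap.ext_ring ?_
  simpa [vec_eq_single] using h t.1 t.2.1 t.2.2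

/-- Left multiplication by `F`. -/
def opF : Module.End ℂ (Space p) := lift fun m i j => vec m (i + 1) j

/-- Left multiplication by `E`. -/
def opE (lam : ZMod p → ℂ) : Module.End ℂ (Space p) := lift fun m i j =>
  vec m i (j + 1) + (lam (m + j) - lam (m + j - i)) • vec m (i - 1) j

/-- Left multiplication by `e n`. -/
def ope (n : ZMod p) : Module.End ℂ (Space p) := lift fun m i j =>
  if n = m + j - i then vec m i j else 0

omit [NeZero p] in
lemma opF_vec (m : ZMod p) (i j : ℕ) : opF (vec m i j) = vec m (i + 1) j :=
  lift_vec _ (fun _ _ _ h => vec_of_le_left (by omega)) (fun _ _ _ h => vec_of_le_right h) _ _ _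

omit [NeZero p] in
lemma opE_vec (lam : ZMod p → ℂ) (m : ZMod p) (i j : ℕ) : opE lam (vec m i j)
    = vec m i (j + 1) + (lam (m + j) - lam (m + j - i)) • vec m (i - 1) j := by
  refine lift_vec _ (fun m i j h => ?_) (fun _ _ _ h => ?_) _ _ _
  · rw [vec_of_le_left h]
    rcases h.eq_or_lt with rfl | h
    · simp
    · rw [vec_of_le_left (by omega)]; simp
  · rw [vec_of_le_right h, vec_of_le_right (by omega)]; simp

omit [NeZero p] in
lemma ope_vec (n m : ZMod p) (i j : ℕ) :
    ope n (vec m i j) = if n = m + j - i then vec m i j else 0 :=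
  lift_vec _ (fun _ _ _ h => by simp [vec_of_le_left h])
    (fun _ _ _ h => by simp [vec_of_le_right h]) _ _ _

lemma cyclicRel (lam : ZMod p → ℂ) : CyclicRel lam (opE lam) opF ope where
  e_mul_e i j := end_ext fun m a b => by
    rw [Module.End.mul_apply, ope_vec]
    split_ifs with h1 h2 h2 <;> simp_all [ope_vec]
  sum_e := end_ext fun m a b => by
    simp [LinearMap.sum_apply, ope_vec]
  E_mul_e n := end_ext fun m a b => by
    simp only [Module.End.mul_apply, opE_vec, ope_vec, map_add, map_smul]
    have h1 : (n + 1 = m + (b + 1 : ℕ) - a) ↔ n = m + b - a := by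
      push_cast; constructor <;> intro h <;> linear_combination h
    simp only [h1]
    rcases a with _ | a
    · split_ifs <;> simp [opE_vec]
    · have h2 : (n + 1 = m + b - (a + 1 - 1 : ℕ)) ↔ n = m + b - (a + 1 : ℕ) := by
        push_cast; constructor <;> intro h <;> linear_combination h
      simp only [h2]
      split_ifs <;> simp [opE_vec]
  F_mul_e n := end_ext fun m a b => by
    simp only [Module.End.mul_apply, opF_vec, ope_vec]
    have h1 : (n = m + b - (a + 1 : ℕ)) ↔ n + 1 = m + b - a := by
      push_cast; constructor <;> intro h <;> linear_combination h
    simp only [h1]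
    split_ifs <;> simp [opF_vec]
  comm := end_ext fun m a b => by
    simp only [LinearMap.sub_apply, Module.End.mul_apply, opE_vec, opF_vec, map_add, map_smul,
      LinearMap.sum_apply, LinearMap.smul_apply, ope_vec, smul_ite, smul_zero,
      Finset.sum_ite_eq', Finset.mem_univ, if_true]
    have h1 : m + (b : ZMod p) - ((a + 1 : ℕ) : ZMod p) = m + b - a - 1 := by push_cast; ring
    rw [h1]
    rcases a with _ | a
    · simp
    · simp [← sub_smul]

omit [NeZero p] in
lemma opF_pow_vec (n : ℕ) (m : ZMod p) (i j : ℕ) :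
    (opF ^ n) (vec m i j) = vec m (i + n) j := by
  induction n with
  | zero => simp
  | succ n ih => rw [pow_succ', Module.End.mul_apply, ih, opF_vec, add_assoc]

omit [NeZero p] in
lemma opE_pow_vec (lam : ZMod p → ℂ) (n : ℕ) (m : ZMod p) (j : ℕ) :
    (opE lam ^ n) (vec m 0 j) = vec m 0 (j + n) := by
  induction n with
  | zero => simp
  | succ n ih => rw [pow_succ', Module.End.mul_apply, ih, opE_vec]; simp [add_assoc]

omit [NeZero p] in
lemma opF_pow : (opF : Module.End ℂ (Space p)) ^ p = 0 :=
  end_ext fun m i j => by rw [opF_pow_vec, vec_of_le_left (by omega)]; simp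

lemma opE_pow (lam : ZMod p → ℂ) : opE lam ^ p = 0 :=
  end_ext fun m i j => by
    have h := ((cyclicRel lam).E_pow_commute_F.pow_right i).eq
    have h2 := congrArg (· (vec m 0 j)) h
    simp only [Module.End.mul_apply, opF_pow_vec, opE_pow_vec, zero_add] at h2
    rw [h2, vec_of_le_right (by omega)]; simp

lemma linearIndependent (lam : ZMod p → ℂ) : LinearIndependent ℂ
    (fun t : ZMod p × Fin p × Fin p => opF ^ (t.2.1 : ℕ) * opE lam ^ (t.2.2 : ℕ) * ope t.1) := by
  refine LinearIndependent.of_comp (LinearMap.applyₗ (R := ℂ) (∑ m : ZMod p, vec m 0 0)) ?_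
  convert! (Finsupp.basisSingleOne (R := ℂ) (ι := ZMod p × Fin p × Fin p)).linearIndependent
    using 1
  ext1 t
  have : ope t.1 (∑ m : ZMod p, vec m 0 0) = vec t.1 0 0 := by
    rw [map_sum, Finset.sum_eq_single t.1] <;> simp +contextual [ope_vec, eq_comm]
  simp only [Function.comp_apply, LinearMap.applyₗ_apply_apply, Module.End.mul_apply, this,
    opE_pow_vec, opF_pow_vec, zero_add, vec_eq_single, Finsupp.coe_basisSingleOne]

end CyclicModel

/-- The subalgebra generated by a set of elements. -/
def Generated {A : Type*} [Ring A] [Algebra ℂ A] (s : Set A) : Type _ := Algebra.adjoin ℂ s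

namespace Generated

variable {A : Type*} [Ring A] [Algebra ℂ A] (s : Set A)

instance : Ring (Generated s) := (Algebra.adjoin ℂ s).toRing

instance : Algebra ℂ (Generated s) := (Algebra.adjoin ℂ s).algebra

/-- The inclusion of the generated subalgebra. -/
def val : Generated s →ₐ[ℂ] A := (Algebra.adjoin ℂ s).val

lemma val_injective : Function.Injective (val s) := Subtype.val_injective

lemma val_mem (x : Generated s) : val s x ∈ Algebra.adjoin ℂ s := x.2

variable {s} in
/-- A generator, as an element of the generated subalgebra. -/
def mk {x : A} (hx : x ∈ s) : Generated s := ⟨x, Algebra.subset_adjoin hx⟩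

end Generated

/-- The algebra generated by `E`, `F` and the weight idempotents. -/
abbrev CyclicAlgebra {p : ℕ} [NeZero p] (lam : ZMod p → ℂ) : Type :=
  Generated ({CyclicModel.opE lam, CyclicModel.opF} ∪ Set.range CyclicModel.ope)

namespace CyclicAlgebra

variable {p : ℕ} [NeZero p] (lam : ZMod p → ℂ)

/-- The inclusion into the endomorphism algebra. -/
def val : CyclicAlgebra lam →ₐ[ℂ] Module.End ℂ (CyclicModel.Space p) := Generated.val _

lemma val_injective : Function.Injective (val lam) := Generated.val_injective _

/-- The raising generator. -/
def E : CyclicAlgebra lam := Generated.mk (x := CyclicModel.opE lam) (by simp)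

/-- The lowering generator. -/
def F : CyclicAlgebra lam := Generated.mk (x := CyclicModel.opF) (by simp)

/-- The weight idempotents. -/
def e (i : ZMod p) : CyclicAlgebra lam := Generated.mk (x := CyclicModel.ope i) (by simp)

lemma val_E : val lam (E lam) = CyclicModel.opE lam := rfl

lemma val_F : val lam (F lam) = CyclicModel.opF := rfl

lemma val_e (i : ZMod p) : val lam (e lam i) = CyclicModel.ope i := rfl

theorem cyclicBasis : CyclicBasis lam (E lam) (F lam) (e lam) where
  e_mul_e i j := val_injective lam <| by
    have := (CyclicModel.cyclicRel lam).e_mul_e i j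
    split_ifs with h <;> simp_all [val_e]
  sum_e := val_injective lam <| by simpa [val_e] using (CyclicModel.cyclicRel lam).sum_e
  E_mul_e i := val_injective lam <| (CyclicModel.cyclicRel lam).E_mul_e i
  F_mul_e i := val_injective lam <| (CyclicModel.cyclicRel lam).F_mul_e i
  comm := val_injective lam <| by
    simpa [val_e, val_E, val_F] using (CyclicModel.cyclicRel lam).comm
  E_pow := val_injective lam <| by simpa [val_E] using CyclicModel.opE_pow lam
  F_pow := val_injective lam <| by simpa [val_F] using CyclicModel.opF_pow (p := p)
  linearIndependent :=
    LinearIndependent.of_comp (val lam).toLinearMap (CyclicModel.linearIndependent lam)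
  span := by
    intro x _
    have h := (CyclicModel.cyclicRel lam).adjoin_le_span (CyclicModel.opE_pow lam)
      CyclicModel.opF_pow (Generated.val_mem _ x)
    rw [show (fun t : ZMod p × Fin p × Fin p => CyclicModel.opF ^ (t.2.1 : ℕ)
        * CyclicModel.opE lam ^ (t.2.2 : ℕ) * CyclicModel.ope t.1)
        = (val lam).toLinearMap ∘ fun t : ZMod p × Fin p × Fin p =>
          F lam ^ (t.2.1 : ℕ) * E lam ^ (t.2.2 : ℕ) * e lam t.1 from rfl,
      Set.range_comp, ← Submodule.map_span] at h
    obtain ⟨y, hy, hyx⟩ := h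
    rwa [← val_injective lam (a₁ := y) (a₂ := x) hyx]

end CyclicAlgebra

/-- The product of the linear factors attached to the points of a cycle. -/
def cyclePoly {p : ℕ} [NeZero p] (lam : ZMod p → ℂ) : ℂ[X] := ∏ i, (X - C (lam i))

section CyclePoly

variable {p : ℕ} [NeZero p] (lam : ZMod p → ℂ)

lemma ZMod.prod_range_natCast {M : Type*} [CommMonoid M] (f : ZMod p → M) :
    ∏ j ∈ Finset.range p, f j = ∏ i, f i := by
  refine Finset.prod_nbij' (fun j : ℕ => (j : ZMod p)) ZMod.val (by simp) ?_ ?_ (by simp) (by simp)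
  · exact fun i _ => Finset.mem_range.2 (ZMod.val_lt i)
  · exact fun j hj => ZMod.val_cast_of_lt (Finset.mem_range.1 hj)

lemma prod_range_add (i : ZMod p) :
    ∏ j ∈ Finset.range p, (X - C (lam (i + j))) = cyclePoly lam := by
  rw [ZMod.prod_range_natCast (fun j => X - C (lam (i + j)))]
  exact Fintype.prod_equiv (Equiv.addLeft i) _ _ fun _ => rfl

lemma prod_range_sub (i : ZMod p) :
    ∏ j ∈ Finset.range p, (X - C (lam (i - j))) = cyclePoly lam := by
  rw [ZMod.prod_range_natCast (fun j => X - C (lam (i - j)))]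
  exact Fintype.prod_equiv (Equiv.subLeft i) _ _ fun _ => rfl

omit [NeZero p] in
lemma ZMod.natCast_pred {n : ℕ} (hn : p = n + 1) : (n : ZMod p) = -1 := by
  have : ((n + 1 : ℕ) : ZMod p) = 0 := by rw [← hn]; simp
  push_cast at this
  linear_combination this

lemma cyclePoly_eq_mul_add {n : ℕ} (hn : p = n + 1) (i : ZMod p) :
    cyclePoly lam = (X - C (lam i)) * ∏ j ∈ Finset.range n, (X - C (lam (i + 1 + j))) := by
  rw [← prod_range_add lam (i + 1)]
  have hr : Finset.range p = Finset.range (n + 1) := by rw [← hn]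
  rw [hr, Finset.prod_range_succ, mul_comm, ZMod.natCast_pred hn]
  simp

lemma cyclePoly_eq_mul_sub {n : ℕ} (hn : p = n + 1) (i : ZMod p) :
    cyclePoly lam = (X - C (lam i)) * ∏ j ∈ Finset.range n, (X - C (lam (i - 1 - j))) := by
  rw [← prod_range_sub lam (i - 1)]
  have hr : Finset.range p = Finset.range (n + 1) := by rw [← hn]
  rw [hr, Finset.prod_range_succ, mul_comm, ZMod.natCast_pred hn]
  simp

lemma cyclePoly_monic : (cyclePoly lam).Monic := monic_prod_of_monic _ _ fun _ _ => monic_X_sub_C _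

lemma cyclePoly_degree : (cyclePoly lam).degree = p := by
  rw [cyclePoly, degree_prod]; simp

/-- Families of polynomials indexed by a cycle whose consecutive members satisfy the gluing
congruences. -/
def cycleSubalgebra : Subalgebra ℂ (ZMod p → ℂ[X]) where
  carrier := {g | ∀ i, cyclePoly lam ∣ (X - C (lam i)) * (g (i + 1) - g i)}
  algebraMap_mem' c i := by simp
  add_mem' {a b} ha hb i := by
    have := dvd_add (ha i) (hb i)
    convert this using 1
    simp only [Pi.add_apply]; ring
  mul_mem' {a b} ha hb i := by
    have := dvd_add ((ha i).mul_right (b (i + 1))) ((hb i).mul_right (a i))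
    convert this using 1
    simp only [Pi.mul_apply]; ring

end CyclePoly

namespace CyclicRel

variable {p : ℕ} [NeZero p] {lam : ZMod p → ℂ} {A : Type*} [Ring A] [Algebra ℂ A]
  {E F : A} {e : ZMod p → A}

local notation "Ω" => casimir lam E F e

/-- Families of polynomials in the Casimir element on the weight spaces. -/
def polyHom (h : CyclicRel lam E F e) : (ZMod p → ℂ[X]) →ₐ[ℂ] A :=
  AlgHom.ofLinearMap
    { toFun := fun g => ∑ i, aeval Ω (g i) * e i
      map_add' := fun f g => by simp [add_mul, Finset.sum_add_distrib]
      map_smul' := fun c g => by simp [Finset.smul_sum] }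
    (by simp [h.sum_e])
    (fun f g => by
      simp only [LinearMap.coe_mk, AddHom.coe_mk, Finset.sum_mul, Finset.mul_sum]
      refine Finset.sum_congr rfl fun i _ => ?_
      rw [Finset.sum_eq_single i]
      · rw [mul_assoc, ← mul_assoc (e i), ← (aeval_casimir_commute (h.casimir_e i) _).eq,
          mul_assoc, h.e_mul_e, if_pos rfl, Pi.mul_apply, map_mul, mul_assoc]
      · intro j _ hj
        rw [mul_assoc, ← mul_assoc (e j), ← (aeval_casimir_commute (h.casimir_e j) _).eq, mul_assoc,
          h.e_mul_e, if_neg hj, mul_zero, mul_zero]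
      · simp)

lemma polyHom_apply (h : CyclicRel lam E F e) (g : ZMod p → ℂ[X]) :
    h.polyHom g = ∑ i, aeval Ω (g i) * e i := rfl

lemma polyHom_mul_e (h : CyclicRel lam E F e) (g : ZMod p → ℂ[X]) (i : ZMod p) :
    h.polyHom g * e i = aeval Ω (g i) * e i := by
  simp [polyHom_apply, Finset.sum_mul, mul_assoc, h.e_mul_e]

lemma e_mul_polyHom (h : CyclicRel lam E F e) (g : ZMod p → ℂ[X]) (i : ZMod p) :
    e i * h.polyHom g = aeval Ω (g i) * e i := by
  simp only [polyHom_apply, Finset.mul_sum, ← mul_assoc,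
    ← (aeval_casimir_commute (h.casimir_e i) _).eq]
  simp [mul_assoc, h.e_mul_e]

end CyclicRel

namespace CyclicBasis

variable {p : ℕ} [NeZero p] {lam : ZMod p → ℂ} {A : Type*} [Ring A] [Algebra ℂ A]
  {E F : A} {e : ZMod p → A}

local notation "Ω" => CyclicRel.casimir lam E F e

lemma aeval_cyclePoly (h : CyclicBasis lam E F e) : aeval Ω (cyclePoly lam) = 0 := by
  refine h.ext_mul_e fun i => ?_
  rw [← prod_range_add lam i, ← h.F_pow_mul_E_pow_mul_e, h.F_pow]
  simp

lemma aeval_mul_E_mul_e (h : CyclicBasis lam E F e) {g : ℂ[X]} {i : ZMod p}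
    (hg : cyclePoly lam ∣ (X - C (lam i)) * g) : aeval Ω g * (E * e i) = 0 := by
  obtain ⟨n, hn⟩ : ∃ n, p = n + 1 := Nat.exists_eq_succ_of_ne_zero (NeZero.ne p)
  rw [cyclePoly_eq_mul_add lam hn i, mul_dvd_mul_iff_left (X_sub_C_ne_zero _)] at hg
  obtain ⟨q, rfl⟩ := hg
  rw [mul_comm, map_mul, mul_assoc, h.E_mul_e, ← mul_assoc (aeval Ω _) (e _),
    ← h.F_pow_mul_E_pow_mul_e, mul_assoc (F ^ n * _), ← h.E_mul_e, mul_assoc (F ^ n),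
    ← mul_assoc (E ^ n), ← pow_succ, ← hn, h.E_pow]
  simp

lemma aeval_mul_F_mul_e (h : CyclicBasis lam E F e) {g : ℂ[X]} {i : ZMod p}
    (hg : cyclePoly lam ∣ (X - C (lam i)) * g) : aeval Ω g * (F * e (i + 1)) = 0 := by
  obtain ⟨n, hn⟩ : ∃ n, p = n + 1 := Nat.exists_eq_succ_of_ne_zero (NeZero.ne p)
  rw [cyclePoly_eq_mul_sub lam hn i, mul_dvd_mul_iff_left (X_sub_C_ne_zero _)] at hg
  obtain ⟨q, rfl⟩ := hg
  rw [mul_comm, map_mul, mul_assoc, h.F_mul_e, ← mul_assoc (aeval Ω _) (e _),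
    ← h.E_pow_mul_F_pow_mul_e, mul_assoc (E ^ n * _), ← h.F_mul_e, mul_assoc (E ^ n),
    ← mul_assoc (F ^ n), ← pow_succ, ← hn, h.F_pow]
  simp

lemma aeval_mul_e_eq_zero_iff (h : CyclicBasis lam E F e) (g : ℂ[X]) (i : ZMod p) :
    aeval Ω g * e i = 0 ↔ cyclePoly lam ∣ g := by
  constructor
  · intro hg
    rw [← modByMonic_eq_zero_iff_dvd (cyclePoly_monic lam)]
    set r := g %ₘ cyclePoly lam with hr
    have hr0 : aeval Ω r * e i = 0 := by
      have := congrArg (fun f => aeval Ω f * e i) (modByMonic_add_div g (cyclePoly lam))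
      simpa [h.aeval_cyclePoly, ← hr, hg] using this
    have hrd : r.degree < p := by
      rw [← cyclePoly_degree lam]; exact degree_modByMonic_lt _ (cyclePoly_monic lam)
    let T : degreeLT ℂ p →ₗ[ℂ] A :=
      LinearMap.mulRight ℂ (e i) ∘ₗ (aeval Ω).toLinearMap ∘ₗ (degreeLT ℂ p).subtype
    let v : Fin p → degreeLT ℂ p := fun n =>
      ⟨∏ j ∈ Finset.range n, (X - C (lam (i + j))), by
        rw [mem_degreeLT, degree_prod]; simp⟩
    have hTv : LinearIndependent ℂ (T ∘ v) := by
      have := h.linearIndependent.comp (fun n : Fin p => (i, n, n)) fun a b hab => by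
        simpa using hab
      convert this using 1
      ext n
      exact (h.F_pow_mul_E_pow_mul_e n i).symm
    have hv : LinearIndependent ℂ v := LinearIndependent.of_comp T hTv
    have hfr : Fintype.card (Fin p) = Module.finrank ℂ (degreeLT ℂ p) := by
      rw [(degreeLTEquiv ℂ p).finrank_eq]; simp
    have : Nonempty (Fin p) := ⟨0⟩
    have hT : Function.Injective T :=
      LinearMap.injective_of_linearIndependent (hv.span_eq_top_of_card_eq_finrank hfr) hTv
    have := @hT ⟨r, mem_degreeLT.2 hrd⟩ 0 (by simpa [T] using hr0)
    simpa using congrArg Subtype.val this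
  · rintro ⟨q, rfl⟩
    rw [map_mul, h.aeval_cyclePoly, zero_mul, zero_mul]

lemma polyHom_eq_zero_iff (h : CyclicBasis lam E F e) (g : ZMod p → ℂ[X]) :
    h.polyHom g = 0 ↔ ∀ i, cyclePoly lam ∣ g i := by
  have (i : ZMod p) : cyclePoly lam ∣ g i ↔ h.polyHom g * e i = 0 := by
    rw [h.polyHom_mul_e, h.aeval_mul_e_eq_zero_iff]
  simp only [this]
  exact ⟨fun h i => by simp [h], fun hg => h.ext_mul_e fun i => by simpa using hg i⟩

lemma mem_center_of_commute (h : CyclicBasis lam E F e) {z : A} (hE : Commute z E)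
    (hF : Commute z F) (he : ∀ i, Commute z (e i)) : z ∈ Subalgebra.center ℂ A := by
  rw [Subalgebra.mem_center_iff]
  intro x
  have hx := h.span (Submodule.mem_top (x := x))
  induction hx using Submodule.span_induction with
  | mem x hx =>
    obtain ⟨t, rfl⟩ := hx
    exact (((hF.pow_right _).mul_right (hE.pow_right _)).mul_right (he _)).eq.symm
  | zero => simp
  | add x y _ _ hx hy => rw [add_mul, mul_add, hx, hy]
  | smul c x _ hx => rw [smul_mul_assoc, mul_smul_comm, hx]

lemma polyHom_mem_center_iff (h : CyclicBasis lam E F e) (g : ZMod p → ℂ[X]) :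
    h.polyHom g ∈ Subalgebra.center ℂ A ↔ g ∈ cycleSubalgebra lam := by
  have hEc (i : ZMod p) : h.polyHom g * E * e i - E * h.polyHom g * e i
      = aeval Ω (g (i + 1) - g i) * (E * e i) := by
    rw [mul_assoc, h.E_mul_e, ← mul_assoc, h.polyHom_mul_e, mul_assoc E, h.polyHom_mul_e,
      ← mul_assoc E, ← (CyclicRel.aeval_casimir_commute h.casimir_E _).eq, mul_assoc _ E, h.E_mul_e,
      mul_assoc, map_sub, sub_mul]
  have hFc (i : ZMod p) : h.polyHom g * F * e (i + 1) - F * h.polyHom g * e (i + 1)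
      = - (aeval Ω (g (i + 1) - g i) * (F * e (i + 1))) := by
    rw [mul_assoc, h.F_mul_e, ← mul_assoc, h.polyHom_mul_e, mul_assoc F, h.polyHom_mul_e,
      ← mul_assoc F, ← (CyclicRel.aeval_casimir_commute h.casimir_F _).eq, mul_assoc _ F, h.F_mul_e,
      mul_assoc, map_sub, sub_mul, neg_sub]
  constructor
  · intro hz i
    have h1 : h.polyHom g * E = E * h.polyHom g := (Subalgebra.mem_center_iff.1 hz E).symm
    have h2 := hEc i
    rw [h1, sub_self] at h2
    rw [← h.aeval_mul_e_eq_zero_iff _ i, mul_comm, map_mul, mul_assoc]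
    have h3 : aeval Ω (X - C (lam i)) * e i = F * E * e i := by
      rw [h.FE_mul_e]; simp [sub_mul, Algebra.smul_def]
    rw [h3, mul_assoc, ← mul_assoc, (CyclicRel.aeval_casimir_commute h.casimir_F _).eq,
      mul_assoc, ← h2, mul_zero]
  · intro hg
    refine h.mem_center_of_commute (h.ext_mul_e fun i => ?_) (h.ext_mul_e fun i => ?_) fun i => ?_
    · rw [← sub_eq_zero, hEc, h.aeval_mul_E_mul_e (hg i)]
    · obtain ⟨i, rfl⟩ : ∃ j, i = j + 1 := ⟨i - 1, by simp⟩
      rw [← sub_eq_zero, hFc, h.aeval_mul_F_mul_e (hg i), neg_zero]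
    · exact (h.polyHom_mul_e g i).trans (h.e_mul_polyHom g i).symm

lemma exists_e_mul_mul_e (h : CyclicBasis lam E F e) (x : A) (i : ZMod p) :
    ∃ g : ℂ[X], e i * x * e i = aeval Ω g * e i := by
  have hx := h.span (Submodule.mem_top (x := x))
  induction hx using Submodule.span_induction with
  | mem x hx =>
    obtain ⟨⟨m, a, b⟩, rfl⟩ := hx
    dsimp only
    by_cases hm : m = i
    · subst hm
      have h1 : e m * (F ^ (a : ℕ) * E ^ (b : ℕ) * e m) * e m
          = F ^ (a : ℕ) * E ^ (b : ℕ) * (e (m + a - b) * e m) := by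
        have h2 := h.F_pow_mul_e a (m + a)
        have h3 := h.E_pow_mul_e b (m + a - b)
        rw [add_sub_cancel_right] at h2
        rw [sub_add_cancel] at h3
        rw [mul_assoc (e m), mul_assoc _ (e m), h.e_mul_e, if_pos rfl, ← mul_assoc, ← mul_assoc,
          ← h2,
          mul_assoc _ (e _), ← h3]
        simp only [mul_assoc]
      rw [h1, mul_assoc, h.e_mul_e]
      split_ifs with hab
      · have hab' : (a : ℕ) = b := by
          have : ((a : ℕ) : ZMod p) = ((b : ℕ) : ZMod p) := by linear_combination hab
          rw [ZMod.natCast_eq_natCast_iff'] at this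
          rwa [Nat.mod_eq_of_lt a.2, Nat.mod_eq_of_lt b.2] at this
        rw [hab, ← mul_assoc, hab']
        exact ⟨_, h.F_pow_mul_E_pow_mul_e b m⟩
      · exact ⟨0, by simp⟩
    · refine ⟨0, ?_⟩
      simp [mul_assoc, h.e_mul_e, hm]
  | zero => exact ⟨0, by simp⟩
  | add x y _ _ hx hy =>
    obtain ⟨f, hf⟩ := hx
    obtain ⟨g, hg⟩ := hy
    exact ⟨f + g, by rw [mul_add, add_mul, hf, hg, map_add, add_mul]⟩
  | smul c x _ hx =>
    obtain ⟨f, hf⟩ := hx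
    exact ⟨c • f, by rw [mul_smul_comm, smul_mul_assoc, hf, map_smul, smul_mul_assoc]⟩

/-- The homomorphism from glued families of polynomials onto the center. -/
def centerHom (h : CyclicBasis lam E F e) : cycleSubalgebra lam →ₐ[ℂ] Subalgebra.center ℂ A :=
  (h.polyHom.comp (cycleSubalgebra lam).val).codRestrict _ fun g =>
    (h.polyHom_mem_center_iff g).2 g.2

lemma coe_centerHom (h : CyclicBasis lam E F e) (g : cycleSubalgebra lam) :
    (h.centerHom g : A) = h.polyHom g := rfl

lemma centerHom_surjective (h : CyclicBasis lam E F e) : Function.Surjective h.centerHom := by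
  rintro ⟨z, hz⟩
  choose g hg using fun i => h.exists_e_mul_mul_e z i
  have hgz : h.polyHom g = z := h.ext_mul_e fun i => by
    rw [h.polyHom_mul_e, ← hg, Subalgebra.mem_center_iff.1 hz, mul_assoc, h.e_mul_e, if_pos rfl]
  exact ⟨⟨g, (h.polyHom_mem_center_iff g).1 (hgz ▸ hz)⟩, Subtype.ext hgz⟩

lemma centerHom_eq_zero_iff (h : CyclicBasis lam E F e) (g : cycleSubalgebra lam) :
    h.centerHom g = 0 ↔ ∀ i, cyclePoly lam ∣ g.1 i := by
  rw [← h.polyHom_eq_zero_iff, ← coe_centerHom]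
  exact Subtype.ext_iff

end CyclicBasis

lemma Polynomial.X_sub_C_sq_dvd_iff (c : ℂ) (f : ℂ[X]) :
    (X - C c) ^ 2 ∣ f ↔ f.eval c = 0 ∧ f.derivative.eval c = 0 := by
  constructor
  · rintro ⟨q, rfl⟩
    simp [derivative_mul, derivative_pow]
  · rintro ⟨h1, h2⟩
    obtain ⟨q, rfl⟩ := dvd_iff_isRoot.2 h1
    rw [pow_two]
    refine mul_dvd_mul_left _ (dvd_iff_isRoot.2 ?_)
    simpa [derivative_mul] using h2

lemma Polynomial.exists_eval_derivative_eq {ι : Type*} [DecidableEq ι] (s : Finset ι) (x : ι → ℂ)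
    (hx : Set.InjOn x s) (r d : ι → ℂ) :
    ∃ g : ℂ[X], ∀ i ∈ s, g.eval (x i) = r i ∧ g.derivative.eval (x i) = d i := by
  let f := Lagrange.interpolate s x r
  let N := Lagrange.nodal s x
  let g := Lagrange.interpolate s x fun i =>
    (d i - f.derivative.eval (x i)) / N.derivative.eval (x i)
  refine ⟨f + N * g, fun i hi => ?_⟩
  have hN : N.eval (x i) = 0 := Lagrange.eval_nodal_at_node hi
  have hN' : N.derivative.eval (x i) ≠ 0 := by
    rw [Lagrange.eval_nodal_derivative_eval_node_eq hi, Lagrange.eval_nodal,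
      Finset.prod_ne_zero_iff]
    intro j hj
    rw [Finset.mem_erase] at hj
    exact sub_ne_zero.2 fun h => hj.1 (hx hj.2 hi h.symm)
  have hg : g.eval (x i) = _ := Lagrange.eval_interpolate_at_node _ hx hi
  have hf : f.eval (x i) = _ := Lagrange.eval_interpolate_at_node _ hx hi
  constructor
  · simp [hN, hf]
  · simp only [derivative_add, derivative_mul, eval_add, eval_mul, hN, hg]
    field_simp
    ring

/-- The fixed points of the reflection `a ↦ σ - a` of a cycle. -/
abbrev ReflFixed {p : ℕ} (σ : ZMod p) : Type := {a : ZMod p // a + a = σ}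

/-- Representatives of the two-element orbits of the reflection `a ↦ σ - a` of a cycle. -/
abbrev ReflPair {p : ℕ} (σ : ZMod p) : Type := {a : ZMod p // a.val < (σ - a).val}

section

variable {p : ℕ} [NeZero p] {lam : ZMod p → ℂ} {σ : ZMod p}

lemma ZMod.prod_univ_refl {M : Type*} [CommMonoid M] (f : ZMod p → M) (hf : ∀ a, f (σ - a) = f a) :
    ∏ a, f a = (∏ a : ReflFixed σ, f a) * ∏ a : ReflPair σ, f a ^ 2 := by
  rw [← Finset.prod_filter_mul_prod_filter_not Finset.univ (fun a : ZMod p => a + a = σ),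
    ← Finset.prod_filter_mul_prod_filter_not (Finset.univ.filter fun a : ZMod p => ¬ a + a = σ)
      (fun a : ZMod p => a.val < (σ - a).val)]
  have h0 (a : ZMod p) : a + a = σ ↔ a.val = (σ - a).val := by
    rw [(ZMod.val_injective p).eq_iff, eq_sub_iff_add_eq]
  have h1 : (Finset.univ.filter fun a : ZMod p => ¬ a + a = σ).filter
      (fun a : ZMod p => a.val < (σ - a).val)
      = Finset.univ.filter (fun a : ZMod p => a.val < (σ - a).val) := by
    ext a; simp only [Finset.mem_filter, Finset.mem_univ, true_and, h0]; omega
  have h2 : ∏ a ∈ (Finset.univ.filter fun a : ZMod p => ¬ a + a = σ).filter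
      (fun a : ZMod p => ¬ a.val < (σ - a).val), f a
      = ∏ a ∈ Finset.univ.filter (fun a : ZMod p => a.val < (σ - a).val), f a := by
    refine Finset.prod_nbij' (fun a => σ - a) (fun a => σ - a) ?_ ?_ (by simp) (by simp)
      (fun a _ => (hf a).symm)
    · intro a
      simp only [Finset.mem_filter, Finset.mem_univ, true_and, h0, sub_sub_cancel]; omega
    · intro a
      simp only [Finset.mem_filter, Finset.mem_univ, true_and, h0, sub_sub_cancel]; omega
  rw [h1, h2, ← pow_two, ← Finset.prod_pow]
  congr 1
  · exact Finset.prod_subtype _ (by simp) _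
  · exact Finset.prod_subtype _ (by simp) _

lemma cyclePoly_dvd_iff (hl : ∀ a b, lam a = lam b ↔ a = b ∨ a + b = σ) (f : ℂ[X]) :
    cyclePoly lam ∣ f ↔ (∀ a : ReflFixed σ, f.eval (lam a) = 0) ∧
      ∀ a : ReflPair σ, f.eval (lam a) = 0 ∧ f.derivative.eval (lam a) = 0 := by
  have hs (a : ZMod p) : lam (σ - a) = lam a := (hl _ _).2 (Or.inr (by ring))
  rw [cyclePoly, ZMod.prod_univ_refl (σ := σ) _ fun a => by rw [hs]]
  simp only [← Polynomial.X_sub_C_sq_dvd_iff]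
  have hcop {a b : ZMod p} (h : lam a ≠ lam b) : IsCoprime (X - C (lam a)) (X - C (lam b)) :=
    isCoprime_X_sub_C_of_isUnit_sub (sub_ne_zero.2 h).isUnit
  constructor
  · intro h
    refine ⟨fun a => dvd_iff_isRoot.1 (((Finset.dvd_prod_of_mem
      (fun a : ReflFixed σ => X - C (lam a))
      (Finset.mem_univ a)).mul_right _).trans h), fun a =>
      (((Finset.dvd_prod_of_mem (fun a : ReflPair σ => (X - C (lam a)) ^ 2)
      (Finset.mem_univ a)).mul_left _).trans h)⟩
  · rintro ⟨h1, h2⟩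
    refine IsCoprime.mul_dvd ?_ ?_ ?_
    · refine IsCoprime.prod_left fun a _ => IsCoprime.prod_right fun b _ => (hcop ?_).pow_right
      rw [Ne, hl]
      rintro (h | h)
      · have := b.2
        rw [← h, sub_eq_iff_eq_add.2 a.2.symm] at this; simp at this
      · have := b.2
        have h3 : (a : ZMod p) = b := by linear_combination a.2 - h
        rw [← h3, sub_eq_iff_eq_add.2 a.2.symm] at this; simp at this
    · refine Finset.prod_dvd_of_coprime (fun a _ b _ hab => hcop ?_)
        fun a _ => dvd_iff_isRoot.2 (h1 a)
      rw [Ne, hl]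
      rintro (h | h)
      · exact hab (Subtype.ext h)
      · exact hab (Subtype.ext (by linear_combination a.2 - h))
    · refine Finset.prod_dvd_of_coprime (fun a _ b _ hab => (hcop ?_).pow) fun a _ => h2 a
      rw [Ne, hl]
      rintro (h | h)
      · exact hab (Subtype.ext h)
      · have h3 : (b : ZMod p) = σ - a := by linear_combination h
        have h4 : (a : ZMod p) = σ - b := by linear_combination h
        have ha := a.2
        have hb := b.2
        rw [← h3] at ha
        rw [← h4] at hb
        omega

omit [NeZero p] in
lemma ZMod.eq_or_eq_of_succ {α : Type*} [NeZero p] {f : ZMod p → α} {a b : ZMod p}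
    (h : ∀ i, i ≠ a → i ≠ b → f (i + 1) = f i) (i : ZMod p) : f i = f a ∨ f i = f b := by
  suffices ∀ n : ℕ, ∀ i : ZMod p, i + n = a → f i = f a ∨ f i = f b from
    this (a - i).val i (by simp)
  intro n
  induction n with
  | zero => intro i hi; left; simp_all
  | succ n ih =>
    intro i hi
    by_cases h1 : i = a
    · simp [h1]
    by_cases h2 : i = b
    · simp [h2]
    rw [← h i h1 h2]
    exact ih _ (by rw [← hi]; push_cast; ring)

/-- The function equal to `u` at `a` and to `v` at `b` that is constant on the two arcs ending
at `a` and `b`. -/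
lemma ZMod.exists_arc {α : Type*} {a b : ZMod p} (hab : a.val < b.val) (u v : α) :
    ∃ f : ZMod p → α, f a = u ∧ f b = v ∧ ∀ i, i ≠ a → i ≠ b → f (i + 1) = f i := by
  refine ⟨fun i => if a.val < i.val ∧ i.val ≤ b.val then v else u, by simp, by simp [hab],
    fun i ha hb => ?_⟩
  have ha' : i.val ≠ a.val := fun h => ha (ZMod.val_injective p h)
  have hb' : i.val ≠ b.val := fun h => hb (ZMod.val_injective p h)
  have hbp := ZMod.val_lt b
  have hip := ZMod.val_lt i
  have : (a.val < (i + 1).val ∧ (i + 1).val ≤ b.val) ↔ (a.val < i.val ∧ i.val ≤ b.val) := by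
    rcases Nat.lt_or_ge (i.val + 1) p with h | h
    · have : (i + 1).val = i.val + 1 := by
        have h1 : i + 1 = ((i.val + 1 : ℕ) : ZMod p) := by simp
        rw [h1, ZMod.val_cast_of_lt h]
      omega
    · have : (i + 1).val = 0 := by
        have h1 : i + 1 = ((i.val + 1 : ℕ) : ZMod p) := by simp
        rw [h1, show i.val + 1 = p by omega]; simp
      omega
  simp only [this]

end

section

variable {p : ℕ} [NeZero p] {lam : ZMod p → ℂ} {σ : ZMod p}

lemma eval_succ_of_mem_cycleSubalgebra {g : ZMod p → ℂ[X]} (hg : g ∈ cycleSubalgebra lam)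
    {a i : ZMod p} (h : lam a ≠ lam i) : (g (i + 1)).eval (lam a) = (g i).eval (lam a) := by
  obtain ⟨q, hq⟩ := hg i
  have h0 : (cyclePoly lam).eval (lam a) = 0 := by
    rw [cyclePoly, eval_prod]
    exact Finset.prod_eq_zero (Finset.mem_univ a) (by simp)
  have := congrArg (eval (lam a)) hq
  simpa [h0, sub_ne_zero.2 h, sub_eq_zero] using this

lemma eval_of_mem_cycleSubalgebra_of_fixed (hl : ∀ a b, lam a = lam b ↔ a = b ∨ a + b = σ)
    {g : ZMod p → ℂ[X]} (hg : g ∈ cycleSubalgebra lam) (a : ReflFixed σ) (i : ZMod p) :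
    (g i).eval (lam a) = (g a).eval (lam a) := by
  have := ZMod.eq_or_eq_of_succ (f := fun i => (g i).eval (lam a)) (a := a) (b := a)
    (fun i hi _ => eval_succ_of_mem_cycleSubalgebra hg ?_) i
  · simpa using this
  · rw [Ne, hl]
    rintro (h | h)
    · exact hi h.symm
    · exact hi (by linear_combination h - a.2)

lemma pair_of_mem_cycleSubalgebra (hl : ∀ a b, lam a = lam b ↔ a = b ∨ a + b = σ)
    {g : ZMod p → ℂ[X]} (hg : g ∈ cycleSubalgebra lam) (a : ReflPair σ) (i : ZMod p) :
    (g (i + 1)).eval (lam a) = (g i).eval (lam a) ∧ (i ≠ a → i ≠ σ - a →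
      (g (i + 1)).derivative.eval (lam a) = (g i).derivative.eval (lam a)) := by
  obtain ⟨h0, h1⟩ := ((cyclePoly_dvd_iff hl _).1 (hg i)).2 a
  simp only [eval_mul, eval_sub, eval_X, eval_C, derivative_mul, derivative_sub, derivative_X,
    derivative_C, sub_zero, one_mul, eval_add] at h0 h1
  have hv : (g (i + 1)).eval (lam a) - (g i).eval (lam a) = 0 := by
    rcases mul_eq_zero.1 h0 with h | h
    · simpa [h] using h1
    · exact h
  refine ⟨sub_eq_zero.1 hv, fun h2 h3 => ?_⟩
  rw [hv, zero_add] at h1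
  refine sub_eq_zero.1 ((mul_eq_zero.1 h1).resolve_left (sub_ne_zero.2 ?_))
  rw [Ne, hl]
  rintro (h | h)
  · exact h2 h.symm
  · exact h3 (by linear_combination h)

lemma eval_of_mem_cycleSubalgebra_of_pair (hl : ∀ a b, lam a = lam b ↔ a = b ∨ a + b = σ)
    {g : ZMod p → ℂ[X]} (hg : g ∈ cycleSubalgebra lam) (a : ReflPair σ) (i : ZMod p) :
    (g i).eval (lam a) = (g a).eval (lam a) := by
  have := ZMod.eq_or_eq_of_succ (f := fun i => (g i).eval (lam a)) (a := a) (b := a)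
    (fun i _ _ => (pair_of_mem_cycleSubalgebra hl hg a i).1) i
  simpa using this

/-- The first-order jets of a glued family at a two-element orbit. -/
def pairJet (hl : ∀ a b, lam a = lam b ↔ a = b ∨ a + b = σ) (a : ReflPair σ) :
    cycleSubalgebra lam →ₐ[ℂ] TrivSqZeroExt ℂ (ℂ × ℂ) :=
  AlgHom.ofLinearMap
    { toFun := fun g => TrivSqZeroExt.inl ((g.1 a).eval (lam a)) + TrivSqZeroExt.inr
        ((g.1 a).derivative.eval (lam a), (g.1 (σ - a)).derivative.eval (lam a))
      map_add' := fun f g => by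
        ext <;> simp
      map_smul' := fun c g => by
        ext <;> simp }
    (by ext <;> simp)
    (fun f g => by
      have h1 := eval_of_mem_cycleSubalgebra_of_pair hl f.2 a (σ - a)
      have h2 := eval_of_mem_cycleSubalgebra_of_pair hl g.2 a (σ - a)
      ext <;> simp [derivative_mul, h1, h2] <;> ring)

lemma pairJet_apply (hl : ∀ a b, lam a = lam b ↔ a = b ∨ a + b = σ) (a : ReflPair σ)
    (g : cycleSubalgebra lam) : pairJet hl a g = TrivSqZeroExt.inl ((g.1 a).eval (lam a)) +
      TrivSqZeroExt.inr ((g.1 a).derivative.eval (lam a),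
        (g.1 (σ - a)).derivative.eval (lam a)) := rfl

/-- The values and first-order jets of a glued family at the orbits of the reflection. -/
def jetHom (hl : ∀ a b, lam a = lam b ↔ a = b ∨ a + b = σ) : cycleSubalgebra lam →ₐ[ℂ]
    (ReflFixed σ → ℂ) × (ReflPair σ → TrivSqZeroExt ℂ (ℂ × ℂ)) :=
  AlgHom.prod
    (AlgHom.pi fun a => (aeval (lam a)).comp
      ((Pi.evalAlgHom ℂ (fun _ : ZMod p => ℂ[X]) (a : ZMod p)).comp (cycleSubalgebra lam).val))
    (AlgHom.pi fun a => pairJet hl a)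

lemma jetHom_apply (hl : ∀ a b, lam a = lam b ↔ a = b ∨ a + b = σ) (g : cycleSubalgebra lam) :
    jetHom hl g = (fun a : ReflFixed σ => (g.1 a).eval (lam a), fun a => pairJet hl a g) := by
  ext <;> simp [jetHom, coe_aeval_eq_eval]

lemma jetHom_eq_zero_iff (hl : ∀ a b, lam a = lam b ↔ a = b ∨ a + b = σ)
    (g : cycleSubalgebra lam) : jetHom hl g = 0 ↔ ∀ i, cyclePoly lam ∣ g.1 i := by
  have h0 : jetHom hl g = 0 ↔ (∀ a : ReflFixed σ, (g.1 a).eval (lam a) = 0) ∧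
      ∀ a : ReflPair σ, (g.1 a).eval (lam a) = 0 ∧ (g.1 a).derivative.eval (lam a) = 0 ∧
        (g.1 (σ - a)).derivative.eval (lam a) = 0 := by
    simp [jetHom_apply, Prod.ext_iff, funext_iff, pairJet_apply, TrivSqZeroExt.ext_iff]
  rw [h0]
  constructor
  · rintro ⟨h1, h2⟩ i
    rw [cyclePoly_dvd_iff hl]
    refine ⟨fun a => ?_, fun a => ⟨?_, ?_⟩⟩
    · rw [eval_of_mem_cycleSubalgebra_of_fixed hl g.2, h1]
    · rw [eval_of_mem_cycleSubalgebra_of_pair hl g.2, (h2 a).1]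
    · rcases ZMod.eq_or_eq_of_succ (f := fun i => (g.1 i).derivative.eval (lam a)) (a := a)
        (b := σ - a) (fun i hi hi' => (pair_of_mem_cycleSubalgebra hl g.2 a i).2 hi hi') i
        with h | h
      · exact h.trans (h2 a).2.1
      · exact h.trans (h2 a).2.2
  · intro h
    simp only [cyclePoly_dvd_iff hl] at h
    exact ⟨fun a => (h a).1 a, fun a => ⟨((h a).2 a).1, ((h a).2 a).2, ((h (σ - a)).2 a).2⟩⟩

lemma jetHom_surjective (hl : ∀ a b, lam a = lam b ↔ a = b ∨ a + b = σ) :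
    Function.Surjective (jetHom hl) := by
  rintro ⟨v, w⟩
  choose D hDa hDb hDs using fun a : ReflPair σ =>
    ZMod.exists_arc a.2 (w a).snd.1 (w a).snd.2
  have hinj : Function.Injective (Sum.elim (fun a : ReflFixed σ => lam a)
      fun a : ReflPair σ => lam a) := by
    rintro (a | a) (b | b) hab <;> simp only [Sum.elim_inl, Sum.elim_inr, hl] at hab
    · rcases hab with h | h
      · exact congrArg _ (Subtype.ext h)
      · exact congrArg _ (Subtype.ext (by linear_combination a.2 - h))
    · exfalso
      have hb := b.2
      have h3 : (a : ZMod p) = b := hab.elim id fun h => by linear_combination a.2 - h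
      rw [← h3, sub_eq_iff_eq_add.2 a.2.symm] at hb
      simp at hb
    · exfalso
      have ha := a.2
      have h3 : (b : ZMod p) = a := hab.elim Eq.symm fun h => by linear_combination b.2 - h
      rw [← h3, sub_eq_iff_eq_add.2 b.2.symm] at ha
      simp at ha
    · rcases hab with h | h
      · exact congrArg _ (Subtype.ext h)
      · have h3 : (b : ZMod p) = σ - a := by linear_combination h
        have h4 : (a : ZMod p) = σ - b := by linear_combination h
        have ha := a.2
        have hb := b.2
        rw [← h3] at ha
        rw [← h4] at hb
        omega
  choose g hg using fun i : ZMod p => Polynomial.exists_eval_derivative_eq Finset.univ _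
    hinj.injOn (Sum.elim v fun a => (w a).fst) (Sum.elim (fun _ => 0) fun a => D a i)
  have hgf (i) (a : ReflFixed σ) : (g i).eval (lam a) = v a :=
    (hg i (Sum.inl a) (Finset.mem_univ _)).1
  have hgp (i) (a : ReflPair σ) : (g i).eval (lam a) = (w a).fst :=
    (hg i (Sum.inr a) (Finset.mem_univ _)).1
  have hgd (i) (a : ReflPair σ) : (g i).derivative.eval (lam a) = D a i :=
    (hg i (Sum.inr a) (Finset.mem_univ _)).2
  have hmem : g ∈ cycleSubalgebra lam := by
    intro i
    rw [cyclePoly_dvd_iff hl]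
    refine ⟨fun a => by simp [hgf], fun a => ⟨by simp [hgp], ?_⟩⟩
    simp only [derivative_mul, derivative_sub, eval_add, eval_mul, eval_sub, hgp, hgd, sub_self,
      mul_zero, zero_add, eval_X, eval_C, mul_eq_zero]
    by_cases h1 : i = a
    · left; simp [h1]
    by_cases h2 : i = σ - a
    · left; rw [sub_eq_zero, hl]; right; rw [h2]; ring
    right; rw [hDs a i h1 h2, sub_self]
  refine ⟨⟨g, hmem⟩, ?_⟩
  rw [jetHom_apply]
  refine Prod.ext (funext fun a => hgf _ a) (funext fun a => ?_)
  dsimp only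
  rw [pairJet_apply]
  dsimp only
  rw [hgp, hgd, hgd, hDa, hDb]
  exact TrivSqZeroExt.inl_fst_add_inr_snd_eq _

/-- The center of an algebra satisfying `CyclicBasis`. -/
theorem CyclicBasis.nonempty_center_equiv {A : Type*} [Ring A] [Algebra ℂ A]
    {E F : A} {e : ZMod p → A} (h : CyclicBasis lam E F e)
    (hl : ∀ a b, lam a = lam b ↔ a = b ∨ a + b = σ) :
    Nonempty (Subalgebra.center ℂ A ≃ₐ[ℂ]
      (ReflFixed σ → ℂ) × (ReflPair σ → TrivSqZeroExt ℂ (ℂ × ℂ))) := by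
  have hker : RingHom.ker h.centerHom = RingHom.ker (jetHom hl) := by
    ext g
    rw [RingHom.mem_ker, RingHom.mem_ker, h.centerHom_eq_zero_iff, jetHom_eq_zero_iff]
  exact ⟨(Ideal.quotientKerAlgEquivOfSurjective h.centerHom_surjective).symm.trans
    ((Ideal.quotientEquivAlgOfEq ℂ hker).trans
      (Ideal.quotientKerAlgEquivOfSurjective (jetHom_surjective hl)))⟩

end

end CyclicAlgebras

namespace LocalB

/-- The images in `LocalB` of the two variables. -/
def var (i : Fin 2) : LocalB := Ideal.Quotient.mk _ (MvPolynomial.X i)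

lemma var_mul_var (i j : Fin 2) : var i * var j = 0 := by
  have h (x : MvPolynomial (Fin 2) ℂ) (hx : x ∈ ({MvPolynomial.X 0 ^ 2,
      MvPolynomial.X 0 * MvPolynomial.X 1, MvPolynomial.X 1 ^ 2} : Set (MvPolynomial (Fin 2) ℂ))) :
      (Ideal.Quotient.mk _ x : LocalB) = 0 :=
    Ideal.Quotient.eq_zero_iff_mem.2 (Ideal.subset_span hx)
  rw [var, var, ← map_mul]
  fin_cases i <;> fin_cases j
  · exact h _ (by simp [pow_two])
  · exact h _ (by simp)
  · exact h _ (by simp [mul_comm])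
  · exact h _ (by simp [pow_two])

/-- The homomorphism to the trivial square-zero extension. -/
def toTriv : LocalB →ₐ[ℂ] TrivSqZeroExt ℂ (ℂ × ℂ) :=
  Ideal.Quotient.liftₐ _ (MvPolynomial.aeval
    ![TrivSqZeroExt.inr ((1, 0) : ℂ × ℂ), TrivSqZeroExt.inr ((0, 1) : ℂ × ℂ)]) fun x hx => by
    induction hx using Submodule.span_induction with
    | mem x hx => rcases hx with rfl | rfl | rfl <;> simp [pow_two]
    | zero => simp
    | add x y _ _ hx hy => rw [map_add, hx, hy, add_zero]
    | smul c x _ hx => rw [smul_eq_mul, map_mul, hx, mul_zero]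

lemma toTriv_var (i : Fin 2) : toTriv (var i) =
    ![TrivSqZeroExt.inr ((1, 0) : ℂ × ℂ), TrivSqZeroExt.inr ((0, 1) : ℂ × ℂ)] i :=
  (Ideal.Quotient.liftₐ_apply _ _ _ _).trans ((Ideal.Quotient.lift_mk _ _ _).trans
    (MvPolynomial.aeval_X _ _))

/-- The linear map sending the two coordinate vectors to given elements. -/
def linMap {A : Type*} [CommRing A] [Algebra ℂ A] (u v : A) : ℂ × ℂ →ₗ[ℂ] A :=
  (LinearMap.toSpanSingleton ℂ A u).coprod (LinearMap.toSpanSingleton ℂ A v)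

lemma linMap_apply {A : Type*} [CommRing A] [Algebra ℂ A] (u v : A) (x : ℂ × ℂ) :
    linMap u v x = x.1 • u + x.2 • v := rfl

lemma linMap_mul_linMap {A : Type*} [CommRing A] [Algebra ℂ A] {u v : A} (huu : u * u = 0)
    (huv : u * v = 0) (hvv : v * v = 0) (x y : ℂ × ℂ) : linMap u v x * linMap u v y = 0 := by
  simp [linMap_apply, add_mul, mul_add, huu, huv, hvv, mul_comm v u]

/-- The homomorphism from the trivial square-zero extension. -/
def ofTriv : TrivSqZeroExt ℂ (ℂ × ℂ) →ₐ[ℂ] LocalB :=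
  TrivSqZeroExt.liftEquivOfComm ⟨linMap (var 0) (var 1),
    linMap_mul_linMap (var_mul_var 0 0) (var_mul_var 0 1) (var_mul_var 1 1)⟩

lemma ofTriv_inr (x : ℂ × ℂ) : ofTriv (TrivSqZeroExt.inr x) = linMap (var 0) (var 1) x := by
  simp [ofTriv]

lemma algHom_ext {A : Type*} [CommRing A] [Algebra ℂ A] {f g : LocalB →ₐ[ℂ] A}
    (h : ∀ i, f (var i) = g (var i)) : f = g :=
  Ideal.Quotient.algHom_ext _ (MvPolynomial.algHom_ext h)

/-- The local algebra as a trivial square-zero extension. -/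
def equivTriv : LocalB ≃ₐ[ℂ] TrivSqZeroExt ℂ (ℂ × ℂ) :=
  AlgEquiv.ofAlgHom toTriv ofTriv
    (by
      refine AlgHom.ext fun x => ?_
      induction x using TrivSqZeroExt.ind with
      | inl_add_inr r m =>
        rw [map_add]
        congr 1
        · exact AlgHom.commutes _ r
        · rw [AlgHom.comp_apply, ofTriv_inr, linMap_apply, map_add, map_smul, map_smul,
            toTriv_var, toTriv_var]
          ext <;> simp)
    (algHom_ext fun i => by
      rw [AlgHom.comp_apply, toTriv_var]
      fin_cases i
      · exact (ofTriv_inr _).trans (by simp [linMap_apply])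
      · exact (ofTriv_inr _).trans (by simp [linMap_apply]))

end LocalB

namespace Subalgebra

variable {A B : Type*} [Ring A] [Algebra ℂ A] [Ring B] [Algebra ℂ B]

/-- An isomorphism of algebras restricts to the centers. -/
def centerEquiv (f : A ≃ₐ[ℂ] B) : center ℂ A ≃ₐ[ℂ] center ℂ B :=
  (f.subalgebraMap (center ℂ A)).trans <| Subalgebra.equivOfEq _ _ <| by
    ext x
    simp only [Subalgebra.mem_map, Subalgebra.mem_center_iff]
    constructor
    · rintro ⟨y, hy, rfl⟩ b
      obtain ⟨a, rfl⟩ := f.surjective b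
      simpa using congrArg f (hy a)
    · intro hx
      refine ⟨f.symm x, fun a => f.injective ?_, by simp⟩
      simpa using hx (f a)

/-- The center of a product. -/
def centerPiEquiv {ι : Type*} (S : ι → Type*) [∀ i, Ring (S i)] [∀ i, Algebra ℂ (S i)] :
    center ℂ (∀ i, S i) ≃ₐ[ℂ] ∀ i, center ℂ (S i) :=
  AlgEquiv.ofBijective
    (AlgHom.pi fun i => ((Pi.evalAlgHom ℂ S i).comp (center ℂ (∀ i, S i)).val).codRestrict _
      fun x => (Subalgebra.center_pi (R := ℂ) (S := S)).le x.2 i trivial)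
    ⟨fun _ _ h => Subtype.ext (funext fun i => congrArg (fun t => (t i : S i)) h),
     fun x => ⟨⟨fun i => x i, (Subalgebra.center_pi (R := ℂ) (S := S)).ge fun i _ => (x i).2⟩,
      rfl⟩⟩

lemma mem_center_tensorProduct_iff (z : A ⊗[ℂ] B) : z ∈ center ℂ (A ⊗[ℂ] B) ↔
    z ∈ (Algebra.TensorProduct.map (center ℂ A).val (center ℂ B).val).range := by
  constructor
  · intro hz
    have hz' := fun x => (Subalgebra.mem_center_iff.1 hz x).symm
    have h1 : z ∈ centralizer ℂ
        ((Algebra.TensorProduct.includeLeft : A →ₐ[ℂ] A ⊗[ℂ] B).range : Set (A ⊗[ℂ] B)) :=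
      fun x _ => (hz' x).symm
    rw [centralizer_coe_range_includeLeft_eq_center_tensorProduct] at h1
    obtain ⟨w, rfl⟩ := h1
    have hinj : Function.Injective
        (Algebra.TensorProduct.map (center ℂ A).val (AlgHom.id ℂ B)) :=
      Module.Flat.rTensor_preserves_injective_linearMap (M := B) (center ℂ A).val.toLinearMap
        Subtype.val_injective
    have h2 : w ∈ centralizer ℂ
        ((Algebra.TensorProduct.includeRight : B →ₐ[ℂ] center ℂ A ⊗[ℂ] B).range :
          Set (center ℂ A ⊗[ℂ] B)) := by
      rintro _ ⟨b, rfl⟩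
      apply hinj
      rw [map_mul, map_mul]
      exact (hz' _).symm
    rw [centralizer_range_includeRight_eq_center_tensorProduct] at h2
    obtain ⟨u, rfl⟩ := h2
    refine ⟨u, ?_⟩
    change Algebra.TensorProduct.map _ _ u = Algebra.TensorProduct.map _ _
      (Algebra.TensorProduct.map _ _ u)
    rw [← AlgHom.comp_apply, ← Algebra.TensorProduct.map_comp]
    rfl
  · rintro ⟨u, rfl⟩
    rw [Subalgebra.mem_center_iff]
    intro x
    induction x with
    | zero => simp
    | add x y hx hy => rw [add_mul, mul_add, hx, hy]
    | tmul a b =>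
      induction u with
      | zero => simp
      | add u v hu hv => rw [map_add, add_mul, mul_add, hu, hv]
      | tmul c d =>
        have hc := Subalgebra.mem_center_iff.1 c.2 a
        have hd := Subalgebra.mem_center_iff.1 d.2 b
        simp [hc, hd]

/-- The center of a tensor product. -/
def centerTensorEquiv : center ℂ (A ⊗[ℂ] B) ≃ₐ[ℂ] center ℂ A ⊗[ℂ] center ℂ B :=
  AlgEquiv.symm <| AlgEquiv.ofBijective
    ((Algebra.TensorProduct.map (center ℂ A).val (center ℂ B).val).codRestrict _ fun x =>
      (mem_center_tensorProduct_iff _).2 ⟨x, rfl⟩)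
    ⟨fun x y h => by
      have h' : TensorProduct.map (center ℂ A).val.toLinearMap (center ℂ B).val.toLinearMap x
          = TensorProduct.map (center ℂ A).val.toLinearMap (center ℂ B).val.toLinearMap y :=
        congrArg Subtype.val h
      exact TensorProduct.map_injective_of_flat_flat _ _ Subtype.val_injective
        Subtype.val_injective h',
     fun z => by
      obtain ⟨u, hu⟩ := (mem_center_tensorProduct_iff _).1 z.2
      exact ⟨u, Subtype.ext hu⟩⟩

end Subalgebra

namespace QG

variable (pp pm : ℕ)

/-- The generators of the quantum group. -/
def gen (x : QGGen) : QG pp pm := RingQuot.mkAlgHom ℂ (QGRel pp pm) (ι ℂ x)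

lemma adjoin_range_gen : Algebra.adjoin ℂ (Set.range (gen pp pm)) = ⊤ := by
  have h : Set.range (gen pp pm)
      = RingQuot.mkAlgHom ℂ (QGRel pp pm) '' Set.range (ι ℂ) := by
    rw [← Set.range_comp]; rfl
  rw [h, ← AlgHom.map_adjoin, FreeAlgebra.adjoin_range_ι, Algebra.map_top,
    AlgHom.range_eq_top]
  exact RingQuot.mkAlgHom_surjective ℂ _

lemma gen_Ep_pow : gen pp pm Ep ^ pp = 0 := by
  simpa using! RingQuot.mkAlgHom_rel ℂ (QGRel.EpNil (pp := pp) (pm := pm))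

lemma gen_Fp_pow : gen pp pm Fp ^ pp = 0 := by
  simpa using! RingQuot.mkAlgHom_rel ℂ (QGRel.FpNil (pp := pp) (pm := pm))

lemma gen_Em_pow : gen pp pm Em ^ pm = 0 := by
  simpa using! RingQuot.mkAlgHom_rel ℂ (QGRel.EmNil (pp := pp) (pm := pm))

lemma gen_Fm_pow : gen pp pm Fm ^ pm = 0 := by
  simpa using! RingQuot.mkAlgHom_rel ℂ (QGRel.FmNil (pp := pp) (pm := pm))

lemma gen_K_pow : gen pp pm K ^ (2 * pp * pm) = 1 := by
  simpa using! RingQuot.mkAlgHom_rel ℂ (QGRel.KOrd (pp := pp) (pm := pm))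

lemma Ep_commute_Em : Commute (gen pp pm Ep) (gen pp pm Em) := by
  simpa using! RingQuot.mkAlgHom_rel ℂ (QGRel.EpEm (pp := pp) (pm := pm))

lemma Fp_commute_Fm : Commute (gen pp pm Fp) (gen pp pm Fm) := by
  simpa using! RingQuot.mkAlgHom_rel ℂ (QGRel.FpFm (pp := pp) (pm := pm))

lemma Ep_commute_Fm : Commute (gen pp pm Ep) (gen pp pm Fm) := by
  simpa using! RingQuot.mkAlgHom_rel ℂ (QGRel.EpFm (pp := pp) (pm := pm))

lemma Em_commute_Fp : Commute (gen pp pm Em) (gen pp pm Fp) := by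
  simpa using! RingQuot.mkAlgHom_rel ℂ (QGRel.EmFp (pp := pp) (pm := pm))

lemma Ep_mul_Fp : ∃ c : ℂ, gen pp pm Ep * gen pp pm Fp = gen pp pm Fp * gen pp pm Ep
    + c • (gen pp pm K ^ pm - gen pp pm K ^ (2 * pp * pm - pm)) := by
  have h := RingQuot.mkAlgHom_rel ℂ (QGRel.EpFp (pp := pp) (pm := pm))
  simp only [map_sub, map_mul, map_pow, AlgHom.commutes] at h
  rw [← Algebra.smul_def] at h
  exact ⟨_, sub_eq_iff_eq_add'.1 h⟩

lemma Em_mul_Fm : ∃ c : ℂ, gen pp pm Em * gen pp pm Fm = gen pp pm Fm * gen pp pm Em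
    + c • (gen pp pm K ^ pp - gen pp pm K ^ (2 * pp * pm - pp)) := by
  have h := RingQuot.mkAlgHom_rel ℂ (QGRel.EmFm (pp := pp) (pm := pm))
  simp only [map_sub, map_mul, map_pow, AlgHom.commutes] at h
  rw [← Algebra.smul_def] at h
  exact ⟨_, sub_eq_iff_eq_add'.1 h⟩

/-- The elements commuting with `K` up to a scalar. -/
def weightSubmonoid : Submonoid (QG pp pm) where
  carrier := {x | ∃ c : ℂ, gen pp pm K * x = c • (x * gen pp pm K)}
  one_mem' := ⟨1, by simp⟩
  mul_mem' := by
    rintro x y ⟨a, hx⟩ ⟨b, hy⟩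
    exact ⟨a * b, by rw [← mul_assoc, hx, smul_mul_assoc, mul_assoc, hy, mul_smul_comm, smul_smul,
      mul_assoc]⟩

lemma gen_mem_weightSubmonoid (x : QGGen) : gen pp pm x ∈ weightSubmonoid pp pm := by
  have key {y : QG pp pm} {c : ℂ} (h : gen pp pm K * y = algebraMap ℂ _ c * (y * gen pp pm K)) :
      y ∈ weightSubmonoid pp pm := ⟨c, by rw [h, ← Algebra.smul_def]⟩
  cases x with
  | Ep => exact key (by simpa only [map_mul, AlgHom.commutes] using!
      RingQuot.mkAlgHom_rel ℂ (QGRel.KEp (pp := pp) (pm := pm)))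
  | Fp => exact key (by simpa only [map_mul, AlgHom.commutes] using!
      RingQuot.mkAlgHom_rel ℂ (QGRel.KFp (pp := pp) (pm := pm)))
  | Em => exact key (by simpa only [map_mul, AlgHom.commutes] using!
      RingQuot.mkAlgHom_rel ℂ (QGRel.KEm (pp := pp) (pm := pm)))
  | Fm => exact key (by simpa only [map_mul, AlgHom.commutes] using!
      RingQuot.mkAlgHom_rel ℂ (QGRel.KFm (pp := pp) (pm := pm)))
  | K => exact ⟨1, by simp⟩

/-- The ordered monomials in the generators. -/
def monomial (a b c d l : ℕ) : QG pp pm :=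
  gen pp pm Fp ^ a * gen pp pm Ep ^ b * gen pp pm Fm ^ c * gen pp pm Em ^ d * gen pp pm K ^ l

/-- The span of the ordered monomials. -/
def monomialSpan : Submodule ℂ (QG pp pm) :=
  Submodule.span ℂ (Set.range fun t : Fin pp × Fin pp × Fin pm × Fin pm × Fin (2 * pp * pm) =>
    monomial pp pm t.1 t.2.1 t.2.2.1 t.2.2.2.1 t.2.2.2.2)

variable {pp pm} in
lemma monomial_mem (hpp : 0 < pp) (hpm : 0 < pm) (a b c d l : ℕ) :
    monomial pp pm a b c d l ∈ monomialSpan pp pm := by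
  have hl : gen pp pm K ^ l = gen pp pm K ^ (l % (2 * pp * pm)) := by
    conv_lhs => rw [← Nat.div_add_mod l (2 * pp * pm), pow_add, pow_mul, gen_K_pow,
      one_pow, one_mul]
  by_cases ha : a < pp
  swap
  · rw [monomial, pow_eq_zero_of_le (not_lt.1 ha) (gen_Fp_pow pp pm)]; simp
  by_cases hb : b < pp
  swap
  · rw [monomial, pow_eq_zero_of_le (not_lt.1 hb) (gen_Ep_pow pp pm)]; simp
  by_cases hc : c < pm
  swap
  · rw [monomial, pow_eq_zero_of_le (not_lt.1 hc) (gen_Fm_pow pp pm)]; simp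
  by_cases hd : d < pm
  swap
  · rw [monomial, pow_eq_zero_of_le (not_lt.1 hd) (gen_Em_pow pp pm)]; simp
  rw [monomial, hl]
  exact Submodule.subset_span ⟨(⟨a, ha⟩, ⟨b, hb⟩, ⟨c, hc⟩, ⟨d, hd⟩,
    ⟨l % (2 * pp * pm), Nat.mod_lt _ (by positivity)⟩), rfl⟩

variable {pp pm} in
lemma mul_mem_monomialSpan {x : QG pp pm}
    (h : ∀ a b c d l, x * monomial pp pm a b c d l ∈ monomialSpan pp pm) {y : QG pp pm}
    (hy : y ∈ monomialSpan pp pm) : x * y ∈ monomialSpan pp pm := by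
  induction hy using Submodule.span_induction with
  | mem y hy => obtain ⟨t, rfl⟩ := hy; exact h _ _ _ _ _
  | zero => simp
  | add y z _ _ hy hz => rw [mul_add]; exact add_mem hy hz
  | smul c y _ hy => rw [mul_smul_comm]; exact Submodule.smul_mem _ _ hy

variable {pp pm} in
lemma gen_mul_mem (hpp : 0 < pp) (hpm : 0 < pm) (x : QGGen) {y : QG pp pm}
    (hy : y ∈ monomialSpan pp pm) : gen pp pm x * y ∈ monomialSpan pp pm := by
  have mem := monomial_mem hpp hpm
  have hK {y : QG pp pm} (hy : y ∈ monomialSpan pp pm) :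
      gen pp pm K * y ∈ monomialSpan pp pm := by
    refine mul_mem_monomialSpan (fun a b c d l => ?_) hy
    have g := gen_mem_weightSubmonoid pp pm
    obtain ⟨s, hs⟩ := mul_mem (mul_mem (mul_mem (mul_mem (pow_mem (g Fp) a) (pow_mem (g Ep) b))
      (pow_mem (g Fm) c)) (pow_mem (g Em) d)) (pow_mem (g K) l)
    rw [monomial, hs, mul_assoc _ (_ ^ l), ← pow_succ]
    exact Submodule.smul_mem _ _ (mem a b c d (l + 1))
  have hKn (n : ℕ) {y : QG pp pm} (hy : y ∈ monomialSpan pp pm) :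
      gen pp pm K ^ n * y ∈ monomialSpan pp pm := by
    induction n with
    | zero => simpa
    | succ n ih => rw [pow_succ', mul_assoc]; exact hK ih
  have hFp {y : QG pp pm} (hy : y ∈ monomialSpan pp pm) :
      gen pp pm Fp * y ∈ monomialSpan pp pm := by
    refine mul_mem_monomialSpan (fun a b c d l => ?_) hy
    convert mem (a + 1) b c d l using 1
    simp only [monomial, pow_succ', mul_assoc]
  have hFm' (a b c d l : ℕ) : gen pp pm Fm * monomial pp pm a b c d l
      = monomial pp pm a b (c + 1) d l := by
    have h1 : Commute (gen pp pm Fm) (gen pp pm Fp ^ a * gen pp pm Ep ^ b) :=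
      ((Fp_commute_Fm pp pm).symm.pow_right a).mul_right ((Ep_commute_Fm pp pm).symm.pow_right b)
    simp only [monomial, ← mul_assoc, h1.eq, pow_succ']
  have hFm {y : QG pp pm} (hy : y ∈ monomialSpan pp pm) :
      gen pp pm Fm * y ∈ monomialSpan pp pm :=
    mul_mem_monomialSpan (fun a b c d l => by rw [hFm']; exact mem _ _ _ _ _) hy
  cases x with
  | K => exact hK hy
  | Fp => exact hFp hy
  | Fm => exact hFm hy
  | Ep =>
    refine mul_mem_monomialSpan (fun a b c d l => ?_) hy
    induction a with
    | zero =>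
      convert mem 0 (b + 1) c d l using 1
      simp only [monomial, pow_succ', pow_zero, one_mul, mul_assoc]
    | succ a ih =>
      obtain ⟨s, hs⟩ := Ep_mul_Fp pp pm
      have h1 : monomial pp pm (a + 1) b c d l = gen pp pm Fp * monomial pp pm a b c d l := by
        simp only [monomial, pow_succ', mul_assoc]
      rw [h1, ← mul_assoc, hs, add_mul, smul_mul_assoc, sub_mul, mul_assoc]
      exact add_mem (hFp ih) (Submodule.smul_mem _ _
        (sub_mem (hKn _ (mem _ _ _ _ _)) (hKn _ (mem _ _ _ _ _))))
  | Em =>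
    refine mul_mem_monomialSpan (fun a b c d l => ?_) hy
    induction c with
    | zero =>
      have h1 : Commute (gen pp pm Em) (gen pp pm Fp ^ a * gen pp pm Ep ^ b) :=
        ((Em_commute_Fp pp pm).pow_right a).mul_right ((Ep_commute_Em pp pm).symm.pow_right b)
      convert mem a b 0 (d + 1) l using 1
      simp only [monomial, pow_succ', pow_zero, mul_one]
      rw [← mul_assoc, ← mul_assoc, h1.eq, mul_assoc _ (gen pp pm Em)]
    | succ c ih =>
      obtain ⟨s, hs⟩ := Em_mul_Fm pp pm
      rw [← hFm', ← mul_assoc, hs, add_mul, smul_mul_assoc, sub_mul, mul_assoc]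
      exact add_mem (hFm ih) (Submodule.smul_mem _ _
        (sub_mem (hKn _ (mem _ _ _ _ _)) (hKn _ (mem _ _ _ _ _))))

variable {pp pm} in
lemma monomialSpan_eq_top (hpp : 0 < pp) (hpm : 0 < pm) : monomialSpan pp pm = ⊤ := by
  refine eq_top_iff.2 fun x hxt => ?_
  clear hxt
  suffices ∀ y ∈ monomialSpan pp pm, x * y ∈ monomialSpan pp pm by
    have h1 := monomial_mem hpp hpm 0 0 0 0 0
    simp only [monomial, pow_zero, mul_one] at h1
    simpa using this 1 h1
  have hx : x ∈ Algebra.adjoin ℂ (Set.range (gen pp pm)) := by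
    rw [adjoin_range_gen]; trivial
  induction hx using Algebra.adjoin_induction with
  | mem x hx => obtain ⟨g, rfl⟩ := hx; exact fun y hy => gen_mul_mem hpp hpm g hy
  | algebraMap c => intro y hy; rw [← Algebra.smul_def]; exact Submodule.smul_mem _ _ hy
  | add x z _ _ hx hz => intro y hy; rw [add_mul]; exact add_mem (hx y hy) (hz y hy)
  | mul x z _ _ hx hz => intro y hy; rw [mul_assoc]; exact hx _ (hz y hy)

variable {pp pm} in
lemma finite_and_finrank_le (hpp : 0 < pp) (hpm : 0 < pm) :
    Module.Finite ℂ (QG pp pm) ∧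
      Module.finrank ℂ (QG pp pm) ≤ 2 * (pp * pp * pp) * (pm * pm * pm) := by
  have h := monomialSpan_eq_top hpp hpm
  refine ⟨⟨h ▸ Submodule.fg_span (Set.finite_range _)⟩, ?_⟩
  have h1 := finrank_range_le_card (R := ℂ) (fun t : Fin pp × Fin pp × Fin pm × Fin pm ×
    Fin (2 * pp * pm) => monomial pp pm t.1 t.2.1 t.2.2.1 t.2.2.2.1 t.2.2.2.2)
  change Module.finrank ℂ (monomialSpan pp pm) ≤ _ at h1
  rw [h, finrank_top] at h1
  refine h1.trans_eq ?_
  simp only [Fintype.card_prod, Fintype.card_fin]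
  ring

end QG

lemma rootOfUnity_ne_zero (p : ℕ) : rootOfUnity p ≠ 0 := Complex.exp_ne_zero _

lemma rootOfUnity_sq (p : ℕ) [NeZero p] : rootOfUnity p ^ 2 = ZMod.stdAddChar (1 : ZMod p) := by
  have := ZMod.stdAddChar_coe (N := p) 1
  rw [Int.cast_one] at this
  rw [this, rootOfUnity, ← Complex.exp_nat_mul]
  congr 1
  push_cast
  ring

lemma rootOfUnity_mul_pow_left (p m : ℕ) [NeZero p] :
    rootOfUnity (p * m) ^ p = rootOfUnity m := by
  rw [rootOfUnity, rootOfUnity, ← Complex.exp_nat_mul]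
  congr 1
  have : (p : ℂ) ≠ 0 := NeZero.ne _
  push_cast
  field_simp

lemma rootOfUnity_mul_pow_right (p m : ℕ) [NeZero m] :
    rootOfUnity (p * m) ^ m = rootOfUnity p := by
  rw [mul_comm, rootOfUnity_mul_pow_left]

lemma rootOfUnity_pow_self (p : ℕ) [NeZero p] : rootOfUnity p ^ p = -1 := by
  rw [rootOfUnity, ← Complex.exp_nat_mul, mul_div_cancel₀ _ (NeZero.ne _), Complex.exp_pi_mul_I]

lemma ZMod.stdAddChar_ne_zero {p : ℕ} [NeZero p] (a : ZMod p) : ZMod.stdAddChar a ≠ 0 :=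
  (ZMod.stdAddChar.val_isUnit a).ne_zero

lemma ZMod.stdAddChar_pow {p : ℕ} [NeZero p] (a : ZMod p) (n : ℕ) :
    ZMod.stdAddChar a ^ n = ZMod.stdAddChar ((n : ZMod p) * a) := by
  rw [← nsmul_eq_mul, AddChar.map_nsmul_eq_pow]

lemma ZMod.stdAddChar_pow_self {p : ℕ} [NeZero p] (a : ZMod p) : ZMod.stdAddChar a ^ p = 1 := by
  simp [ZMod.stdAddChar_pow]

lemma ZMod.stdAddChar_eq_one_iff {p : ℕ} [NeZero p] (a : ZMod p) :
    ZMod.stdAddChar a = 1 ↔ a = 0 := by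
  rw [← AddChar.map_zero_eq_one (ZMod.stdAddChar (N := p)), ZMod.injective_stdAddChar.eq_iff]

section Parameters

variable (p m d : ℕ) [NeZero p]

/-- The eigenvalues of `K ^ m` on the factor of `g` of order `p` belonging to the parity `d`. -/
def halfWeight (a : ZMod p) : ℂ := rootOfUnity p ^ d * ZMod.stdAddChar ((m : ZMod p) * a)

lemma halfWeight_ne_zero (a : ZMod p) : halfWeight p m d a ≠ 0 :=
  mul_ne_zero (pow_ne_zero _ (rootOfUnity_ne_zero p)) (ZMod.stdAddChar_ne_zero _)

lemma halfWeight_add_one (a : ZMod p) :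
    halfWeight p m d (a + 1) = (rootOfUnity p ^ m) ^ 2 * halfWeight p m d a := by
  rw [halfWeight, halfWeight, mul_add, AddChar.map_add_eq_mul, ← pow_mul, mul_comm m 2, pow_mul,
    rootOfUnity_sq, ZMod.stdAddChar_pow]
  ring

/-- The Casimir eigenvalues on the factor of `g` of order `p` belonging to the parity `d`. -/
def casimirValue (a : ZMod p) : ℂ :=
  (halfWeight p m d a * rootOfUnity p ^ m + (halfWeight p m d a * rootOfUnity p ^ m)⁻¹)
    / (rootOfUnity p ^ m - (rootOfUnity p ^ m)⁻¹) ^ 2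

lemma casimirValue_sub (a : ZMod p) :
    casimirValue p m d a - casimirValue p m d (a - 1)
      = (rootOfUnity p ^ m - (rootOfUnity p ^ m)⁻¹)⁻¹
        * (halfWeight p m d a - (halfWeight p m d a)⁻¹) := by
  have h := halfWeight_add_one p m d (a - 1)
  rw [sub_add_cancel] at h
  have hQ : rootOfUnity p ^ m ≠ 0 := pow_ne_zero _ (rootOfUnity_ne_zero p)
  have ht := halfWeight_ne_zero p m d (a - 1)
  rw [casimirValue, casimirValue, h]
  set Q := rootOfUnity p ^ m
  set t := halfWeight p m d (a - 1)
  by_cases hs : Q - Q⁻¹ = 0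
  · simp [hs]
  rw [← sub_div, eq_inv_mul_iff_mul_eq₀ hs, ← mul_div_assoc, div_eq_iff (pow_ne_zero 2 hs)]
  field_simp
  ring

/-- The center of the reflection of `ZMod p` identifying the weights with equal Casimir value. -/
def reflCenter : ZMod p := -1 - d * (m : ZMod p)⁻¹

variable {p m} in
lemma casimirValue_eq_iff (hp : 2 ≤ p) (hm : Nat.Coprime m p) (a b : ZMod p) :
    casimirValue p m d a = casimirValue p m d b ↔ a = b ∨ a + b = reflCenter p m d := by
  have hQ : rootOfUnity p ^ m ≠ 0 := pow_ne_zero _ (rootOfUnity_ne_zero p)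
  have hu : (m : ZMod p) * (m : ZMod p)⁻¹ = 1 := ZMod.coe_mul_inv_eq_one m hm
  have hm0 : (m : ZMod p) ≠ 0 := by
    have : Fact (1 < p) := ⟨hp⟩
    intro h
    simp [h] at hu
  have hmi : Function.Injective ((m : ZMod p) * ·) :=
    (IsUnit.of_mul_eq_one _ hu).mul_right_injective
  have hQ2 : (rootOfUnity p ^ m) ^ 2 = ZMod.stdAddChar (m : ZMod p) := by
    rw [← pow_mul, mul_comm m 2, pow_mul, rootOfUnity_sq, ZMod.stdAddChar_pow, mul_one]
  have hs : rootOfUnity p ^ m - (rootOfUnity p ^ m)⁻¹ ≠ 0 := by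
    intro h
    rw [sub_eq_zero, ← mul_eq_one_iff_eq_inv₀ hQ, ← sq, hQ2, ZMod.stdAddChar_eq_one_iff] at h
    exact hm0 h
  have h1 : casimirValue p m d a = casimirValue p m d b ↔
      (halfWeight p m d a - halfWeight p m d b)
        * (halfWeight p m d a * halfWeight p m d b * (rootOfUnity p ^ m) ^ 2 - 1) = 0 := by
    have ha := halfWeight_ne_zero p m d a
    have hb := halfWeight_ne_zero p m d b
    rw [casimirValue, casimirValue, div_left_inj' (pow_ne_zero 2 hs), ← sub_eq_zero]
    set x := halfWeight p m d a
    set y := halfWeight p m d b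
    set Q := rootOfUnity p ^ m
    have : x * Q + (x * Q)⁻¹ - (y * Q + (y * Q)⁻¹)
        = (x - y) * (x * y * Q ^ 2 - 1) / (x * y * Q) := by
      field_simp
      ring
    rw [this, div_eq_zero_iff, or_iff_left (by positivity)]
  rw [h1, mul_eq_zero, sub_eq_zero, sub_eq_zero]
  refine or_congr ?_ ?_
  · rw [halfWeight, halfWeight, mul_right_inj' (pow_ne_zero _ (rootOfUnity_ne_zero p)),
      ZMod.injective_stdAddChar.eq_iff, hmi.eq_iff]
  · have h2 : halfWeight p m d a * halfWeight p m d b * (rootOfUnity p ^ m) ^ 2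
        = ZMod.stdAddChar ((d : ZMod p) + (m : ZMod p) * (a + b + 1)) := by
      have h3 : (rootOfUnity p ^ d) ^ 2 = ZMod.stdAddChar (d : ZMod p) := by
        rw [← pow_mul, mul_comm d 2, pow_mul, rootOfUnity_sq, ZMod.stdAddChar_pow, mul_one]
      rw [hQ2, halfWeight, halfWeight, AddChar.map_add_eq_mul, ← h3, mul_add, mul_add,
        AddChar.map_add_eq_mul, AddChar.map_add_eq_mul, mul_one]
      ring
    rw [h2, ZMod.stdAddChar_eq_one_iff, reflCenter]
    constructor
    · intro h
      apply hmi
      linear_combination h + (d : ZMod p) * hu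
    · intro h
      rw [h]
      linear_combination (-(d : ZMod p)) * hu

end Parameters

namespace CyclicRel

variable {p : ℕ} [NeZero p] {lam : ZMod p → ℂ} {A : Type*} [Ring A] [Algebra ℂ A]
  {E F : A} {e : ZMod p → A}

/-- The functions of the weight, as elements of the algebra. -/
def diagHom (h : CyclicRel lam E F e) : (ZMod p → ℂ) →ₐ[ℂ] A :=
  AlgHom.ofLinearMap (Fintype.linearCombination ℂ e)
    (by simp [Fintype.linearCombination_apply, h.sum_e]) fun x y => h.ext_mul_e fun i => by
      simp only [Fintype.linearCombination_apply]
      rw [mul_assoc, h.sum_smul_mul_e, h.sum_smul_mul_e, mul_smul_comm, h.sum_smul_mul_e,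
        smul_smul, mul_comm, Pi.mul_apply]

lemma diagHom_mul_e (h : CyclicRel lam E F e) (x : ZMod p → ℂ) (i : ZMod p) :
    h.diagHom x * e i = x i • e i := h.sum_smul_mul_e x i

lemma diagHom_mul_E (h : CyclicRel lam E F e) {x : ZMod p → ℂ} {c : ℂ}
    (hx : ∀ i, x (i + 1) = c * x i) : h.diagHom x * E = c • (E * h.diagHom x) :=
  h.ext_mul_e fun i => by
    rw [mul_assoc, h.E_mul_e, ← mul_assoc, diagHom_mul_e, smul_mul_assoc, smul_mul_assoc,
      mul_assoc, diagHom_mul_e, mul_smul_comm, h.E_mul_e, smul_smul, hx]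

lemma diagHom_mul_F (h : CyclicRel lam E F e) {x : ZMod p → ℂ} {c : ℂ} (hc : c ≠ 0)
    (hx : ∀ i, x (i + 1) = c * x i) : h.diagHom x * F = c⁻¹ • (F * h.diagHom x) :=
  h.ext_mul_e fun i => by
    obtain ⟨i, rfl⟩ : ∃ j, i = j + 1 := ⟨i - 1, by simp⟩
    rw [mul_assoc, h.F_mul_e, ← mul_assoc, diagHom_mul_e, smul_mul_assoc, smul_mul_assoc,
      mul_assoc, diagHom_mul_e, mul_smul_comm, h.F_mul_e, smul_smul, hx, inv_mul_cancel_left₀ hc]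

lemma comm_eq_diagHom (h : CyclicRel lam E F e) :
    E * F - F * E = h.diagHom fun i => lam i - lam (i - 1) := h.comm

end CyclicRel

namespace QG

variable {pp pm d : ℕ} [NeZero pp] [NeZero pm]
  {A : Type*} [Ring A] [Algebra ℂ A] {E F : A} {e : ZMod pp → A}
  {B : Type*} [Ring B] [Algebra ℂ B] {E' F' : B} {e' : ZMod pm → B}

/-- The image of `K` in the tensor product of two cyclic algebras. -/
def weightElt (hA : CyclicRel (casimirValue pp pm d) E F e)
    (hB : CyclicRel (casimirValue pm pp d) E' F' e') : A ⊗[ℂ] B :=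
  rootOfUnity (pp * pm) ^ d • (hA.diagHom ZMod.stdAddChar ⊗ₜ hB.diagHom ZMod.stdAddChar)

lemma rootOfUnity_pow_eq_one : (rootOfUnity (pp * pm) ^ d) ^ (2 * pp * pm) = 1 := by
  rw [← pow_mul, show d * (2 * pp * pm) = pp * pm * (2 * d) by ring, pow_mul,
    rootOfUnity_pow_self, pow_mul, neg_one_sq, one_pow]

lemma diagHom_stdAddChar_pow {p : ℕ} [NeZero p] {lam : ZMod p → ℂ} {E F : A} {e : ZMod p → A}
    (h : CyclicRel lam E F e) (n : ℕ) : h.diagHom ZMod.stdAddChar ^ n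
      = h.diagHom fun a => ZMod.stdAddChar ((n : ZMod p) * a) := by
  rw [← map_pow]
  congr 1
  funext a
  exact ZMod.stdAddChar_pow a n

lemma diagHom_stdAddChar_pow_mul {p : ℕ} [NeZero p] {lam : ZMod p → ℂ} {E F : A} {e : ZMod p → A}
    (h : CyclicRel lam E F e) (n : ℕ) : h.diagHom ZMod.stdAddChar ^ (p * n) = 1 := by
  rw [diagHom_stdAddChar_pow, ← map_one h.diagHom]
  congr 1
  funext a
  simp

variable (hA : CyclicRel (casimirValue pp pm d) E F e)
  (hB : CyclicRel (casimirValue pm pp d) E' F' e')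

lemma weightElt_pow : weightElt hA hB ^ (2 * pp * pm) = 1 := by
  rw [weightElt, smul_pow, rootOfUnity_pow_eq_one, one_smul, Algebra.TensorProduct.tmul_pow,
    show 2 * pp * pm = pp * (2 * pm) by ring, diagHom_stdAddChar_pow_mul,
    show pp * (2 * pm) = pm * (2 * pp) by ring, diagHom_stdAddChar_pow_mul,
    Algebra.TensorProduct.one_def]

lemma weightElt_pow_left : weightElt hA hB ^ pm = hA.diagHom (halfWeight pp pm d) ⊗ₜ 1 := by
  have h := diagHom_stdAddChar_pow_mul hB 1
  rw [mul_one] at h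
  rw [weightElt, smul_pow, ← pow_mul, mul_comm d, pow_mul, rootOfUnity_mul_pow_right,
    Algebra.TensorProduct.tmul_pow, h, diagHom_stdAddChar_pow, TensorProduct.smul_tmul',
    ← map_smul]
  rfl

lemma weightElt_pow_right : weightElt hA hB ^ pp = 1 ⊗ₜ hB.diagHom (halfWeight pm pp d) := by
  have h := diagHom_stdAddChar_pow_mul hA 1
  rw [mul_one] at h
  rw [weightElt, smul_pow, ← pow_mul, mul_comm d, pow_mul, rootOfUnity_mul_pow_left,
    Algebra.TensorProduct.tmul_pow, h, diagHom_stdAddChar_pow, ← TensorProduct.tmul_smul,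
    ← map_smul]
  rfl

lemma halfWeight_mul_inv {p : ℕ} [NeZero p] (m d : ℕ) :
    halfWeight p m d * (halfWeight p m d)⁻¹ = 1 :=
  funext fun a => mul_inv_cancel₀ (halfWeight_ne_zero p m d a)

lemma weightElt_pow_sub_left : weightElt hA hB ^ (2 * pp * pm - pm)
    = hA.diagHom (halfWeight pp pm d)⁻¹ ⊗ₜ 1 := by
  have hle : pm ≤ 2 * pp * pm :=
    Nat.le_mul_of_pos_left _ (Nat.mul_pos two_pos (NeZero.pos pp))
  refine left_inv_eq_right_inv (a := weightElt hA hB ^ pm) ?_ ?_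
  · rw [← pow_add, Nat.sub_add_cancel hle, weightElt_pow]
  · rw [weightElt_pow_left, Algebra.TensorProduct.tmul_mul_tmul, ← map_mul, one_mul,
      halfWeight_mul_inv, map_one, Algebra.TensorProduct.one_def]

lemma weightElt_pow_sub_right : weightElt hA hB ^ (2 * pp * pm - pp)
    = 1 ⊗ₜ hB.diagHom (halfWeight pm pp d)⁻¹ := by
  have hle : pp ≤ 2 * pp * pm := by nlinarith [NeZero.pos pm, NeZero.pos pp]
  refine left_inv_eq_right_inv (a := weightElt hA hB ^ pp) ?_ ?_
  · rw [← pow_add, Nat.sub_add_cancel hle, weightElt_pow]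
  · rw [weightElt_pow_right, Algebra.TensorProduct.tmul_mul_tmul, ← map_mul, one_mul,
      halfWeight_mul_inv, map_one, Algebra.TensorProduct.one_def]

/-- The images of the generators in the tensor product of two cyclic algebras. -/
def genImage : QGGen → A ⊗[ℂ] B
  | Ep => E ⊗ₜ 1
  | Fp => F ⊗ₜ 1
  | Em => 1 ⊗ₜ E'
  | Fm => 1 ⊗ₜ F'
  | K => weightElt hA hB

lemma lift_genImage_rel (hE : E ^ pp = 0) (hF : F ^ pp = 0) (hE' : E' ^ pm = 0) (hF' : F' ^ pm = 0)
    ⦃x y : FreeAlgebra ℂ QGGen⦄ (h : QGRel pp pm x y) :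
    FreeAlgebra.lift ℂ (genImage hA hB) x = FreeAlgebra.lift ℂ (genImage hA hB) y := by
  have hs {p : ℕ} [NeZero p] (i : ZMod p) :
      ZMod.stdAddChar (i + 1) = rootOfUnity p ^ 2 * ZMod.stdAddChar i := by
    rw [rootOfUnity_sq, AddChar.map_add_eq_mul, mul_comm]
  have hq (p : ℕ) : rootOfUnity p ^ 2 ≠ 0 := pow_ne_zero _ (rootOfUnity_ne_zero p)
  cases h <;> simp only [map_pow, map_mul, map_sub, map_zero, map_one, AlgHom.commutes,
    FreeAlgebra.lift_ι_apply, genImage]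
  case EpNil => simp [hE]
  case FpNil => simp [hF]
  case EmNil => simp [hE']
  case FmNil => simp [hF']
  case KOrd => exact weightElt_pow hA hB
  case KEp =>
    rw [← map_pow, ← Algebra.smul_def, weightElt, smul_mul_assoc, mul_smul_comm,
      Algebra.TensorProduct.tmul_mul_tmul, Algebra.TensorProduct.tmul_mul_tmul,
      hA.diagHom_mul_E hs, mul_one, one_mul, ← TensorProduct.smul_tmul', smul_comm]
  case KFp =>
    rw [← Algebra.smul_def, weightElt, smul_mul_assoc, mul_smul_comm,
      Algebra.TensorProduct.tmul_mul_tmul, Algebra.TensorProduct.tmul_mul_tmul,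
      hA.diagHom_mul_F (hq pp) hs, mul_one, one_mul, ← TensorProduct.smul_tmul', smul_comm]
  case KEm =>
    rw [← map_pow, ← Algebra.smul_def, weightElt, smul_mul_assoc, mul_smul_comm,
      Algebra.TensorProduct.tmul_mul_tmul, Algebra.TensorProduct.tmul_mul_tmul,
      hB.diagHom_mul_E hs, mul_one, one_mul, TensorProduct.tmul_smul, smul_comm]
  case KFm =>
    rw [← Algebra.smul_def, weightElt, smul_mul_assoc, mul_smul_comm,
      Algebra.TensorProduct.tmul_mul_tmul, Algebra.TensorProduct.tmul_mul_tmul,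
      hB.diagHom_mul_F (hq pm) hs, mul_one, one_mul, TensorProduct.tmul_smul, smul_comm]
  case EpEm => simp
  case FpFm => simp
  case EpFm => simp
  case EmFp => simp
  case EpFp =>
    rw [← Algebra.smul_def, weightElt_pow_left, weightElt_pow_sub_left,
      Algebra.TensorProduct.tmul_mul_tmul, Algebra.TensorProduct.tmul_mul_tmul,
      ← TensorProduct.sub_tmul, ← TensorProduct.sub_tmul, mul_one, hA.comm_eq_diagHom,
      TensorProduct.smul_tmul', ← map_sub, ← map_smul]
    congr 2
    funext a
    exact casimirValue_sub pp pm d a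
  case EmFm =>
    rw [← Algebra.smul_def, weightElt_pow_right, weightElt_pow_sub_right,
      Algebra.TensorProduct.tmul_mul_tmul, Algebra.TensorProduct.tmul_mul_tmul,
      ← TensorProduct.tmul_sub, ← TensorProduct.tmul_sub, mul_one, hB.comm_eq_diagHom,
      ← TensorProduct.tmul_smul, ← map_sub, ← map_smul]
    congr 2
    funext a
    exact casimirValue_sub pm pp d a

/-- The representation of the quantum group on the tensor product of two cyclic algebras. -/
def repHom (hA : CyclicBasis (casimirValue pp pm d) E F e)
    (hB : CyclicBasis (casimirValue pm pp d) E' F' e') : QG pp pm →ₐ[ℂ] A ⊗[ℂ] B :=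
  RingQuot.liftAlgHom ℂ ⟨FreeAlgebra.lift ℂ (genImage hA.toCyclicRel hB.toCyclicRel),
    lift_genImage_rel _ _ hA.E_pow hA.F_pow hB.E_pow hB.F_pow⟩

lemma repHom_gen (hA : CyclicBasis (casimirValue pp pm d) E F e)
    (hB : CyclicBasis (casimirValue pm pp d) E' F' e') (x : QGGen) :
    repHom hA hB (gen pp pm x) = genImage hA.toCyclicRel hB.toCyclicRel x := by
  rw [repHom, gen, RingQuot.liftAlgHom_mkAlgHom_apply, FreeAlgebra.lift_ι_apply]

end QG

lemma Polynomial.aeval_mul_of_eigenvector {A : Type*} [Ring A] [Algebra ℂ A] {x v : A} {c : ℂ}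
    (h : x * v = c • v) (f : Polynomial ℂ) : Polynomial.aeval x f * v = f.eval c • v := by
  induction f using Polynomial.induction_on' with
  | add f g hf hg => rw [map_add, add_mul, hf, hg, Polynomial.eval_add, add_smul]
  | monomial n a =>
    have hn : x ^ n * v = c ^ n • v := by
      induction n with
      | zero => simp
      | succ n ih => rw [pow_succ, mul_assoc, h, mul_smul_comm, ih, smul_smul, ← pow_succ']
    rw [Polynomial.aeval_monomial, ← Algebra.smul_def, smul_mul_assoc, hn,
      Polynomial.eval_monomial, smul_smul]

namespace CyclicBasis

variable {p m : ℕ} [NeZero p] [NeZero m] {lam : ZMod p → ℂ} {lam' : ZMod m → ℂ}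
  {A : Type*} [Ring A] [Algebra ℂ A] {E F : A} {e : ZMod p → A}
  {B : Type*} [Ring B] [Algebra ℂ B] {E' F' : B} {e' : ZMod m → B}

lemma finite (h : CyclicBasis lam E F e) : Module.Finite ℂ A :=
  Module.Finite.of_basis (Module.Basis.mk h.linearIndependent h.span)

lemma finrank_eq (h : CyclicBasis lam E F e) : Module.finrank ℂ A = p * p * p := by
  rw [Module.finrank_eq_card_basis (Module.Basis.mk h.linearIndependent h.span)]
  simp [mul_assoc]

lemma finite_tensorProduct (h : CyclicBasis lam E F e) (h' : CyclicBasis lam' E' F' e') :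
    Module.Finite ℂ (A ⊗[ℂ] B) :=
  have := h.finite
  have := h'.finite
  inferInstance

lemma finrank_tensorProduct (h : CyclicBasis lam E F e) (h' : CyclicBasis lam' E' F' e') :
    Module.finrank ℂ (A ⊗[ℂ] B) = (p * p * p) * (m * m * m) := by
  rw [Module.finrank_tensorProduct, h.finrank_eq, h'.finrank_eq]

end CyclicBasis

namespace QG

variable (pp pm : ℕ) [NeZero pp] [NeZero pm]

/-- The eigenvalues of `K`. -/
def weight (t : Fin 2 × ZMod pp × ZMod pm) : ℂ :=
  rootOfUnity (pp * pm) ^ (t.1 : ℕ) * (ZMod.stdAddChar t.2.1 * ZMod.stdAddChar t.2.2)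

variable {pp pm} in
lemma weight_injective (hco : Nat.Coprime pp pm) : Function.Injective (weight pp pm) := by
  rintro ⟨d, a, b⟩ ⟨d', a', b'⟩ h
  have hc := rootOfUnity_ne_zero (pp * pm)
  have hd : d = d' := by
    have h1 := congrArg (· ^ (pp * pm)) h
    have h2 (d : Fin 2) (a : ZMod pp) (b : ZMod pm) :
        weight pp pm (d, a, b) ^ (pp * pm) = (-1) ^ (d : ℕ) := by
      rw [weight, mul_pow, mul_pow, ← pow_mul, mul_comm (d : ℕ), pow_mul, rootOfUnity_pow_self,
        pow_mul, ZMod.stdAddChar_pow_self, mul_comm pp, pow_mul, ZMod.stdAddChar_pow_self]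
      simp
    simp only [h2] at h1
    fin_cases d <;> fin_cases d' <;> norm_num at h1 <;> rfl
  subst hd
  have h1 : ZMod.stdAddChar a * ZMod.stdAddChar b = ZMod.stdAddChar a' * ZMod.stdAddChar b' :=
    mul_left_cancel₀ (pow_ne_zero _ hc) h
  have ha : a = a' := by
    have h2 := congrArg (· ^ pm) h1
    simp only [mul_pow, ZMod.stdAddChar_pow_self, mul_one] at h2
    rw [ZMod.stdAddChar_pow, ZMod.stdAddChar_pow, ZMod.injective_stdAddChar.eq_iff] at h2
    exact (IsUnit.of_mul_eq_one _ (ZMod.coe_mul_inv_eq_one pm hco.symm)).mul_right_injective h2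
  subst ha
  rw [ZMod.injective_stdAddChar (mul_left_cancel₀ (ZMod.stdAddChar_ne_zero a) h1)]

section

variable {pp pm} {d : Fin 2}
  {A : Type*} [Ring A] [Algebra ℂ A] {E F : A} {e : ZMod pp → A}
  {B : Type*} [Ring B] [Algebra ℂ B] {E' F' : B} {e' : ZMod pm → B}

lemma weightElt_mul_tmul (hA : CyclicRel (casimirValue pp pm d) E F e)
    (hB : CyclicRel (casimirValue pm pp d) E' F' e') (a : ZMod pp) (b : ZMod pm) :
    weightElt hA hB * (e a ⊗ₜ e' b) = weight pp pm (d, a, b) • (e a ⊗ₜ e' b) := by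
  rw [weightElt, smul_mul_assoc, Algebra.TensorProduct.tmul_mul_tmul, hA.diagHom_mul_e,
    hB.diagHom_mul_e, TensorProduct.tmul_smul, ← TensorProduct.smul_tmul', smul_smul, smul_smul,
    weight]
  congr 1
  ring

lemma aeval_weightElt (hA : CyclicRel (casimirValue pp pm d) E F e)
    (hB : CyclicRel (casimirValue pm pp d) E' F' e') (f : Polynomial ℂ) :
    Polynomial.aeval (weightElt hA hB) f
      = ∑ a, ∑ b, f.eval (weight pp pm (d, a, b)) • (e a ⊗ₜ[ℂ] e' b) := by
  have h1 : ∑ a, ∑ b, e a ⊗ₜ[ℂ] e' b = 1 := by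
    simp_rw [← TensorProduct.tmul_sum, ← TensorProduct.sum_tmul, hA.sum_e, hB.sum_e]
    rfl
  rw [← mul_one (Polynomial.aeval _ f), ← h1]
  simp_rw [Finset.mul_sum, Polynomial.aeval_mul_of_eigenvector (weightElt_mul_tmul hA hB _ _)]

lemma repHom_monomial_mul (hA : CyclicBasis (casimirValue pp pm d) E F e)
    (hB : CyclicBasis (casimirValue pm pp d) E' F' e') (i j k l : ℕ) (x : A) (y : B) :
    repHom hA hB (gen pp pm Fp ^ i * gen pp pm Ep ^ j * (gen pp pm Fm ^ k * gen pp pm Em ^ l))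
      * (x ⊗ₜ y) = (F ^ i * E ^ j * x) ⊗ₜ (F' ^ k * E' ^ l * y) := by
  simp only [map_mul, map_pow, repHom_gen, genImage, Algebra.TensorProduct.tmul_pow, one_pow,
    Algebra.TensorProduct.tmul_mul_tmul, one_mul, mul_one]

end

/-- The quantum group maps to the product of the tensor products of cyclic algebras. -/
def blockHom : QG pp pm →ₐ[ℂ] ∀ d : Fin 2,
    CyclicAlgebra (casimirValue pp pm d) ⊗[ℂ] CyclicAlgebra (casimirValue pm pp d) :=
  AlgHom.pi fun d => repHom (CyclicAlgebra.cyclicBasis (casimirValue pp pm d))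
    (CyclicAlgebra.cyclicBasis (casimirValue pm pp d))

lemma blockHom_apply (x : QG pp pm) (d : Fin 2) : blockHom pp pm x d
    = repHom (CyclicAlgebra.cyclicBasis (casimirValue pp pm d))
      (CyclicAlgebra.cyclicBasis (casimirValue pm pp d)) x := rfl

open CyclicAlgebra in
variable {pp pm} in
lemma exists_blockHom_eq_single (hco : Nat.Coprime pp pm) (d : Fin 2) (a : ZMod pp)
    (b : ZMod pm) : ∃ x, blockHom pp pm x
      = Pi.single d (e (casimirValue pp pm d) a ⊗ₜ e (casimirValue pm pp d) b) := by
  classical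
  have hinj := weight_injective hco
  refine ⟨Polynomial.aeval (gen pp pm K)
    (Lagrange.basis Finset.univ (weight pp pm) (d, a, b)), ?_⟩
  have hf (s : Fin 2 × ZMod pp × ZMod pm) : (Lagrange.basis Finset.univ (weight pp pm)
      (d, a, b)).eval (weight pp pm s) = if (d, a, b) = s then 1 else 0 := by
    split_ifs with h
    · rw [← h, Lagrange.eval_basis_self hinj.injOn (Finset.mem_univ _)]
    · rw [Lagrange.eval_basis_of_ne h (Finset.mem_univ _)]
  funext d'
  rw [blockHom_apply, ← Polynomial.aeval_algHom_apply, repHom_gen, genImage, aeval_weightElt]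
  simp_rw [hf]
  by_cases hd : d = d'
  · subst hd
    simp [Prod.mk.injEq, ite_and]
  · simp [hd]

open CyclicAlgebra in
variable {pp pm} in
lemma blockHom_surjective (hco : Nat.Coprime pp pm) : Function.Surjective (blockHom pp pm) := by
  have key (d : Fin 2) (z : CyclicAlgebra (casimirValue pp pm d) ⊗[ℂ]
      CyclicAlgebra (casimirValue pm pp d)) : Pi.single d z ∈ (blockHom pp pm).range := by
    have hmono (s : ZMod pp × Fin pp × Fin pp) (t : ZMod pm × Fin pm × Fin pm) :
        Pi.single d ((F (casimirValue pp pm d) ^ (s.2.1 : ℕ) * E (casimirValue pp pm d)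
          ^ (s.2.2 : ℕ) * e (casimirValue pp pm d) s.1) ⊗ₜ[ℂ] (F (casimirValue pm pp d)
          ^ (t.2.1 : ℕ) * E (casimirValue pm pp d) ^ (t.2.2 : ℕ) * e (casimirValue pm pp d) t.1))
          ∈ (blockHom pp pm).range := by
      obtain ⟨x, hx⟩ := exists_blockHom_eq_single hco d s.1 t.1
      refine ⟨gen pp pm Fp ^ (s.2.1 : ℕ) * gen pp pm Ep ^ (s.2.2 : ℕ) * (gen pp pm Fm ^ (t.2.1 : ℕ)
        * gen pp pm Em ^ (t.2.2 : ℕ)) * x, ?_⟩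
      change blockHom pp pm _ = _
      rw [map_mul, hx]
      funext d'
      rw [Pi.mul_apply]
      by_cases hd : d = d'
      · subst hd
        rw [Pi.single_eq_same, Pi.single_eq_same, blockHom_apply]
        exact repHom_monomial_mul _ _ _ _ _ _ _ _
      · rw [Pi.single_eq_of_ne (Ne.symm hd), Pi.single_eq_of_ne (Ne.symm hd), mul_zero]
    let N := (Subalgebra.toSubmodule (blockHom pp pm).range).comap (LinearMap.single ℂ _ d)
    change z ∈ N
    induction z with
    | zero => exact N.zero_mem
    | add x y hx hy => exact N.add_mem hx hy
    | tmul x y =>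
      have hx := (cyclicBasis (casimirValue pp pm d)).span (Submodule.mem_top (x := x))
      have hy := (cyclicBasis (casimirValue pm pp d)).span (Submodule.mem_top (x := y))
      induction hx using Submodule.span_induction with
      | zero => rw [TensorProduct.zero_tmul]; exact N.zero_mem
      | add x x' _ _ hx hx' => rw [TensorProduct.add_tmul]; exact N.add_mem hx hx'
      | smul c x _ hx => rw [← TensorProduct.smul_tmul']; exact N.smul_mem _ hx
      | mem x hx =>
        obtain ⟨s, rfl⟩ := hx
        induction hy using Submodule.span_induction with
        | zero => rw [TensorProduct.tmul_zero]; exact N.zero_mem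
        | add y y' _ _ hy hy' => rw [TensorProduct.tmul_add]; exact N.add_mem hy hy'
        | smul c y _ hy => rw [TensorProduct.tmul_smul]; exact N.smul_mem _ hy
        | mem y hy => obtain ⟨t, rfl⟩ := hy; exact hmono s t
  intro y
  rw [← AlgHom.mem_range, ← Finset.univ_sum_single y]
  exact sum_mem fun d _ => key d (y d)

variable {pp pm} in
lemma blockHom_bijective (hco : Nat.Coprime pp pm) : Function.Bijective (blockHom pp pm) := by
  obtain ⟨h1, h2⟩ := finite_and_finrank_le (NeZero.pos pp) (NeZero.pos pm)
  have hs := blockHom_surjective hco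
  have (d : Fin 2) := (CyclicAlgebra.cyclicBasis (casimirValue pp pm d)).finite_tensorProduct
    (CyclicAlgebra.cyclicBasis (casimirValue pm pp d))
  have hr (d : Fin 2) := (CyclicAlgebra.cyclicBasis (casimirValue pp pm d)).finrank_tensorProduct
    (CyclicAlgebra.cyclicBasis (casimirValue pm pp d))
  refine ⟨?_, hs⟩
  have h3 : Module.finrank ℂ (QG pp pm) = Module.finrank ℂ (∀ d : Fin 2,
      CyclicAlgebra (casimirValue pp pm d) ⊗[ℂ] CyclicAlgebra (casimirValue pm pp d)) := by
    refine le_antisymm (h2.trans_eq ?_)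
      (LinearMap.finrank_le_finrank_of_surjective (f := (blockHom pp pm).toLinearMap) hs)
    rw [Module.finrank_pi_fintype, Fin.sum_univ_two, hr, hr]
    ring
  exact (LinearMap.injective_iff_surjective_of_finrank_eq_finrank
    (f := (blockHom pp pm).toLinearMap) h3).2 hs

variable {pp pm} in
/-- The quantum group is a product of two tensor products of cyclic algebras. -/
def blockEquiv (hco : Nat.Coprime pp pm) : QG pp pm ≃ₐ[ℂ] ∀ d : Fin 2,
    CyclicAlgebra (casimirValue pp pm d) ⊗[ℂ] CyclicAlgebra (casimirValue pm pp d) :=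
  AlgEquiv.ofBijective (blockHom pp pm) (blockHom_bijective hco)

end QG

lemma card_reflFixed_add_card_reflPair {p : ℕ} [NeZero p] (σ : ZMod p) :
    Fintype.card (ReflFixed σ) + 2 * Fintype.card (ReflPair σ) = p := by
  have h := ZMod.prod_univ_refl (σ := σ) (M := ℕ) (fun _ => 2) fun _ => rfl
  simp only [Finset.prod_const, Finset.card_univ, ← pow_mul, ← pow_add, ZMod.card] at h
  exact (Nat.pow_right_injective le_rfl h).symm

lemma card_reflFixed_of_odd {p : ℕ} [NeZero p] (hp : Odd p) (σ : ZMod p) :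
    Fintype.card (ReflFixed σ) = 1 := by
  have hu : (2 : ZMod p) * (2 : ZMod p)⁻¹ = 1 := by
    exact_mod_cast ZMod.coe_mul_inv_eq_one 2 (Nat.coprime_two_left.2 hp)
  refine Fintype.card_eq_one_iff.2 ⟨⟨(2 : ZMod p)⁻¹ * σ, ?_⟩, fun a => Subtype.ext ?_⟩
  · linear_combination σ * hu
  · change (a : ZMod p) = (2 : ZMod p)⁻¹ * σ
    linear_combination -(a : ZMod p) * hu + (2 : ZMod p)⁻¹ * a.2

lemma ZMod.add_self_eq_zero_iff_of_even {k : ℕ} [NeZero (2 * k)] (x : ZMod (2 * k)) :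
    x + x = 0 ↔ x = 0 ∨ x = (k : ZMod (2 * k)) := by
  constructor
  · intro h
    have hx := ZMod.val_lt x
    rw [← ZMod.natCast_zmod_val x, ← Nat.cast_add, ZMod.natCast_eq_zero_iff] at h
    obtain ⟨c, hc⟩ := h
    have h1 : x.val = k * c := by linarith
    have hk : 0 < k := by linarith
    have hc2 : c < 2 := by
      by_contra! hc2
      nlinarith
    interval_cases c
    · left
      rw [← ZMod.val_eq_zero, h1, mul_zero]
    · right
      rw [← ZMod.natCast_zmod_val x, h1, mul_one]
  · rintro (rfl | rfl)
    · simp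
    · rw [← Nat.cast_add, ← two_mul, ZMod.natCast_self]

lemma card_reflFixed_of_even {k : ℕ} [NeZero (2 * k)] (a : ZMod (2 * k)) :
    Fintype.card (ReflFixed (a + a)) = 2 := by
  have hk : (k : ZMod (2 * k)) ≠ 0 := by
    have := NeZero.pos (2 * k)
    rw [Ne, ZMod.natCast_eq_zero_iff]
    intro h
    have := Nat.le_of_dvd (by linarith) h
    linarith
  rw [Fintype.card_subtype, show (Finset.univ.filter fun b : ZMod (2 * k) => b + b = a + a)
    = {a, a + k} from ?_, Finset.card_pair (by simpa using hk)]
  ext b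
  have h := ZMod.add_self_eq_zero_iff_of_even (b - a)
  simp only [Finset.mem_filter, Finset.mem_univ, true_and, Finset.mem_insert,
    Finset.mem_singleton]
  rw [sub_eq_zero, sub_eq_iff_eq_add'] at h
  rw [← h, ← sub_eq_zero, add_sub_add_comm]

lemma card_reflFixed_add_card_reflFixed {p m : ℕ} [NeZero p] (hco : Nat.Coprime m p) :
    Fintype.card (ReflFixed (reflCenter p m 0)) + Fintype.card (ReflFixed (reflCenter p m 1))
      = 2 := by
  rcases Nat.even_or_odd' p with ⟨k, hk | hk⟩
  swap
  · rw [card_reflFixed_of_odd ⟨k, hk⟩, card_reflFixed_of_odd ⟨k, hk⟩]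
  subst hk
  have hu := ZMod.coe_mul_inv_eq_one m hco
  have h2 : 2 ∣ 2 * k := Dvd.intro k rfl
  have h0 : Fintype.card (ReflFixed (reflCenter (2 * k) m 0)) = 0 := by
    rw [Fintype.card_eq_zero_iff]
    refine ⟨fun ⟨a, ha⟩ => ?_⟩
    have := congrArg (ZMod.castHom h2 (ZMod 2)) ha
    simp only [reflCenter, map_add, CharTwo.add_self_eq_zero, map_neg, map_one,
      Nat.cast_zero, zero_mul, sub_zero] at this
    exact absurd this (by decide)
  obtain ⟨a, ha⟩ : ∃ a, reflCenter (2 * k) m 1 = a + a := by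
    have h3 : Odd ((m : ZMod (2 * k))⁻¹).val := by
      have := congrArg (ZMod.castHom h2 (ZMod 2)) hu
      by_contra hodd
      rw [Nat.not_odd_iff_even] at hodd
      rw [map_mul, map_one, ← ZMod.natCast_zmod_val (m : ZMod (2 * k))⁻¹, map_natCast,
        map_natCast, (ZMod.natCast_eq_zero_iff_even).2 hodd, mul_zero] at this
      exact absurd this (by decide)
    obtain ⟨w, hw⟩ := h3
    refine ⟨-(w + 1 : ZMod (2 * k)), ?_⟩
    rw [reflCenter, ← ZMod.natCast_zmod_val (m : ZMod (2 * k))⁻¹, hw]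
    push_cast
    ring
  rw [h0, ha, card_reflFixed_of_even]

lemma sum_mul_of_odd {p m : ℕ} {f f' n n' : Fin 2 → ℕ} (hp : Odd p) (hf : ∀ d, f d = 1)
    (hf' : f' 0 + f' 1 = 2) (hn : ∀ d, f d + 2 * n d = p) (hn' : ∀ d, f' d + 2 * n' d = m) :
    f 0 * f' 0 + f 1 * f' 1 = 2 ∧ n 0 * f' 0 + n 1 * f' 1 = p - 1 ∧
      f 0 * n' 0 + f 1 * n' 1 = m - 1 ∧ n 0 * n' 0 + n 1 * n' 1 = (p - 1) * (m - 1) / 2 := by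
  obtain ⟨k, rfl⟩ := hp
  have hk (d : Fin 2) : n d = k := by have := hn d; rw [hf] at this; omega
  have h0 := hn' 0
  have h1 := hn' 1
  have hm : n' 0 + n' 1 = m - 1 := by omega
  refine ⟨by simp [hf, hf'], ?_, by simp [hf, hm], ?_⟩
  · rw [hk, hk, ← mul_add, hf']; omega
  · rw [hk, hk, ← mul_add, hm, Nat.add_sub_cancel, mul_assoc, Nat.mul_div_cancel_left _ two_pos]

lemma sum_card_mul_card {p m : ℕ} [NeZero p] [NeZero m] (hco : Nat.Coprime p m) :
    let f (d : Fin 2) := Fintype.card (ReflFixed (reflCenter p m d))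
    let n (d : Fin 2) := Fintype.card (ReflPair (reflCenter p m d))
    let f' (d : Fin 2) := Fintype.card (ReflFixed (reflCenter m p d))
    let n' (d : Fin 2) := Fintype.card (ReflPair (reflCenter m p d))
    f 0 * f' 0 + f 1 * f' 1 = 2 ∧ n 0 * f' 0 + n 1 * f' 1 = p - 1 ∧
      f 0 * n' 0 + f 1 * n' 1 = m - 1 ∧ n 0 * n' 0 + n 1 * n' 1 = (p - 1) * (m - 1) / 2 := by
  intro f n f' n'
  have hf : f 0 + f 1 = 2 := card_reflFixed_add_card_reflFixed hco.symm
  have hf' : f' 0 + f' 1 = 2 := card_reflFixed_add_card_reflFixed hco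
  have hn (d : Fin 2) : f d + 2 * n d = p := card_reflFixed_add_card_reflPair _
  have hn' (d : Fin 2) : f' d + 2 * n' d = m := card_reflFixed_add_card_reflPair _
  rcases Nat.even_or_odd p with hp | hp
  · have hm : Odd m := by
      rw [← Nat.not_even_iff_odd]
      exact fun hm => Nat.not_coprime_of_dvd_of_dvd one_lt_two hp.two_dvd hm.two_dvd hco
    obtain ⟨h1, h2, h3, h4⟩ :=
      sum_mul_of_odd hm (fun _ => card_reflFixed_of_odd hm _) hf hn' hn
    simp only [mul_comm (f _), mul_comm (n _), mul_comm (p - 1)]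
    exact ⟨h1, h3, h2, h4⟩
  · exact sum_mul_of_odd hp (fun _ => card_reflFixed_of_odd hp _) hf' hn hn'

namespace AlgEquiv

/-- Currying of functions with values in an algebra. -/
def piSigma {D : Type*} (α : D → Type*) (X : Type*) [Semiring X] [Algebra ℂ X] :
    (∀ d, α d → X) ≃ₐ[ℂ] ((Σ d, α d) → X) where
  toFun f t := f t.1 t.2
  invFun g d a := g ⟨d, a⟩
  map_mul' _ _ := rfl
  map_add' _ _ := rfl
  commutes' _ := rfl

/-- A product of products. -/
def piProd {D : Type*} (P Q : D → Type*) [∀ d, Semiring (P d)] [∀ d, Algebra ℂ (P d)]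
    [∀ d, Semiring (Q d)] [∀ d, Algebra ℂ (Q d)] :
    (∀ d, P d × Q d) ≃ₐ[ℂ] (∀ d, P d) × (∀ d, Q d) where
  toFun f := (fun d => (f d).1, fun d => (f d).2)
  invFun g d := (g.1 d, g.2 d)
  map_mul' _ _ := rfl
  map_add' _ _ := rfl
  commutes' _ := rfl

/-- Functions on a type with two elements. -/
def finTwoProd (X : Type*) [Semiring X] [Algebra ℂ X] : (Fin 2 → X) ≃ₐ[ℂ] X × X where
  toFun f := (f 0, f 1)
  invFun x := ![x.1, x.2]
  left_inv f := by funext i; fin_cases i <;> rfl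
  map_mul' _ _ := rfl
  map_add' _ _ := rfl
  commutes' _ := rfl

/-- The associativity of products. -/
def prodAssoc' (X Y Z : Type*) [Semiring X] [Algebra ℂ X] [Semiring Y] [Algebra ℂ Y]
    [Semiring Z] [Algebra ℂ Z] : ((X × Y) × Z) ≃ₐ[ℂ] X × Y × Z where
  toFun f := (f.1.1, f.1.2, f.2)
  invFun f := ((f.1, f.2.1), f.2.2)
  map_mul' _ _ := rfl
  map_add' _ _ := rfl
  commutes' _ := rfl

variable {f n f' n' : Type*} [Fintype f] [Fintype n] [Fintype f'] [Fintype n']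
  [DecidableEq f'] [DecidableEq n'] [DecidableEq f] [DecidableEq n]

/-- The tensor product of two function algebras. -/
def tensorPi (X Y : Type*) [CommSemiring X] [Algebra ℂ X] [CommSemiring Y] [Algebra ℂ Y] :
    (f → X) ⊗[ℂ] (f' → Y) ≃ₐ[ℂ] (f × f' → X ⊗[ℂ] Y) :=
  ((Algebra.TensorProduct.piRight ℂ ℂ (f → X) fun _ : f' => Y).trans <|
    piCongrRight fun _ => (Algebra.TensorProduct.comm ℂ (f → X) Y).trans <|
      (Algebra.TensorProduct.piRight ℂ ℂ Y fun _ : f => X).trans <|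
        piCongrRight fun _ => Algebra.TensorProduct.comm ℂ Y X).trans <|
  { toFun := fun g t => g t.2 t.1
    invFun := fun g k i => g (i, k)
    left_inv := fun _ => rfl
    right_inv := fun _ => rfl
    map_mul' := fun _ _ => rfl
    map_add' := fun _ _ => rfl
    commutes' := fun _ => rfl }

/-- Tensor products distribute over binary products on the left. -/
def prodTensor (X Y Z : Type*) [CommSemiring X] [Algebra ℂ X] [CommSemiring Y] [Algebra ℂ Y]
    [CommSemiring Z] [Algebra ℂ Z] : (X × Y) ⊗[ℂ] Z ≃ₐ[ℂ] X ⊗[ℂ] Z × Y ⊗[ℂ] Z :=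
  (Algebra.TensorProduct.comm ℂ (X × Y) Z).trans <|
    (Algebra.TensorProduct.prodRight ℂ ℂ Z X Y).trans <|
      prodCongr (Algebra.TensorProduct.comm ℂ Z X) (Algebra.TensorProduct.comm ℂ Z Y)

/-- The tensor product of two binary products. -/
def tensorProd (X Y X₁ Y₁ : Type*) [CommSemiring X] [Algebra ℂ X] [CommSemiring Y] [Algebra ℂ Y]
    [CommSemiring X₁] [Algebra ℂ X₁] [CommSemiring Y₁] [Algebra ℂ Y₁] :
    (X × Y) ⊗[ℂ] (X₁ × Y₁) ≃ₐ[ℂ] (X ⊗[ℂ] X₁ × Y ⊗[ℂ] X₁) × (X ⊗[ℂ] Y₁ × Y ⊗[ℂ] Y₁) :=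
  (Algebra.TensorProduct.prodRight ℂ ℂ (X × Y) X₁ Y₁).trans <|
    prodCongr (prodTensor X Y X₁) (prodTensor X Y Y₁)

/-- The tensor product of two products of copies of `ℂ` and of a local algebra `T`. -/
def tensorBlocks (T : Type*) [CommSemiring T] [Algebra ℂ T] :
    ((f → ℂ) × (n → T)) ⊗[ℂ] ((f' → ℂ) × (n' → T)) ≃ₐ[ℂ]
      ((f × f' → ℂ) × (n × f' → T)) × ((f × n' → T) × (n × n' → T ⊗[ℂ] T)) :=
  (tensorProd _ _ _ _).trans <| prodCongr
    (prodCongr ((tensorPi ℂ ℂ).trans (piCongrRight fun _ => Algebra.TensorProduct.lid ℂ ℂ))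
      ((tensorPi T ℂ).trans (piCongrRight fun _ => Algebra.TensorProduct.rid ℂ ℂ T)))
    (prodCongr ((tensorPi ℂ T).trans (piCongrRight fun _ => Algebra.TensorProduct.lid ℂ T))
      (tensorPi T T))

/-- Functions on a finite type are functions on an initial segment. -/
def piFin {α : Type*} [Fintype α] {k : ℕ} (h : Fintype.card α = k) (X : Type*) [Semiring X]
    [Algebra ℂ X] : (α → X) ≃ₐ[ℂ] (Fin k → X) :=
  piCongrLeft ℂ (fun _ => X) (Fintype.equivFinOfCardEq h)

end AlgEquiv

lemma CyclicBasis.nonempty_center_tensor_equiv {p p' : ℕ} [NeZero p] [NeZero p']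
    {lam : ZMod p → ℂ} {lam' : ZMod p' → ℂ} {σ : ZMod p} {σ' : ZMod p'}
    {A : Type*} [Ring A] [Algebra ℂ A] {E F : A} {e : ZMod p → A}
    {A' : Type*} [Ring A'] [Algebra ℂ A'] {E' F' : A'} {e' : ZMod p' → A'}
    (h : CyclicBasis lam E F e) (hl : ∀ a b, lam a = lam b ↔ a = b ∨ a + b = σ)
    (h' : CyclicBasis lam' E' F' e') (hl' : ∀ a b, lam' a = lam' b ↔ a = b ∨ a + b = σ') :
    Nonempty (Subalgebra.center ℂ (A ⊗[ℂ] A') ≃ₐ[ℂ]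
      ((ReflFixed σ × ReflFixed σ' → ℂ) × (ReflPair σ × ReflFixed σ' → LocalB)) ×
        ((ReflFixed σ × ReflPair σ' → LocalB) ×
          (ReflPair σ × ReflPair σ' → LocalB ⊗[ℂ] LocalB))) := by
  classical
  obtain ⟨f⟩ := h.nonempty_center_equiv hl
  obtain ⟨f'⟩ := h'.nonempty_center_equiv hl'
  exact ⟨Subalgebra.centerTensorEquiv.trans <| (Algebra.TensorProduct.congr
    (f.trans (AlgEquiv.prodCongr .refl (.piCongrRight fun _ => LocalB.equivTriv.symm)))
    (f'.trans (AlgEquiv.prodCongr .refl (.piCongrRight fun _ => LocalB.equivTriv.symm)))).trans <|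
    AlgEquiv.tensorBlocks LocalB⟩

/-- A product over two indices of products of blocks, with the blocks of each kind collected. -/
def AlgEquiv.collectBlocks {f n f' n' : Fin 2 → Type} [∀ d, Fintype (f d)] [∀ d, Fintype (n d)]
    [∀ d, Fintype (f' d)] [∀ d, Fintype (n' d)] {k l m : ℕ}
    (h2 : Fintype.card (Σ d, f d × f' d) = 2) (hk : Fintype.card (Σ d, n d × f' d) = k)
    (hl : Fintype.card (Σ d, f d × n' d) = l) (hm : Fintype.card (Σ d, n d × n' d) = m)
    (T U : Type) [CommSemiring T] [Algebra ℂ T] [CommSemiring U] [Algebra ℂ U] :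
    (∀ d, ((f d × f' d → ℂ) × (n d × f' d → T)) × ((f d × n' d → T) × (n d × n' d → U))) ≃ₐ[ℂ]
      ℂ × ℂ × (Fin k → T) × (Fin l → T) × (Fin m → U) :=
  (piProd _ _).trans <|
    (prodCongr
      ((piProd _ _).trans (prodCongr
        ((piSigma _ ℂ).trans ((piFin h2 ℂ).trans (finTwoProd ℂ)))
        ((piSigma _ T).trans (piFin hk T))))
      ((piProd _ _).trans (prodCongr
        ((piSigma _ T).trans (piFin hl T))
        ((piSigma _ U).trans (piFin hm U))))).trans <|
    (prodAssoc' _ _ _).trans (prodAssoc' _ _ _)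

set_option synthInstance.maxHeartbeats 1000000 in
/-- The center of `g_{p₊,p₋}` is isomorphic as a ℂ-algebra to
`ℂ × ℂ × B^{p₊−1} × B^{p₋−1} × (B ⊗ B)^{(p₊−1)(p₋−1)/2}`. -/
theorem center_structure (pp pm : ℕ) (hpp : 2 ≤ pp) (hpm : 2 ≤ pm)
    (hco : Nat.Coprime pp pm) :
    Nonempty
      ((Subalgebra.center ℂ (QG pp pm)) ≃ₐ[ℂ]
        (ℂ × ℂ × (Fin (pp - 1) → LocalB) × (Fin (pm - 1) → LocalB) ×
          (Fin ((pp - 1) * (pm - 1) / 2) → (LocalB ⊗[ℂ] LocalB)))) := by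
  classical
  have : NeZero pp := ⟨by omega⟩
  have : NeZero pm := ⟨by omega⟩
  let g (d : Fin 2) := (CyclicBasis.nonempty_center_tensor_equiv
    (CyclicAlgebra.cyclicBasis (casimirValue pp pm d))
    (casimirValue_eq_iff d hpp hco.symm)
    (CyclicAlgebra.cyclicBasis (casimirValue pm pp d))
    (casimirValue_eq_iff d hpm hco)).some
  obtain ⟨h1, h2, h3, h4⟩ := sum_card_mul_card hco
  exact ⟨(Subalgebra.centerEquiv (QG.blockEquiv hco)).trans <|
    (Subalgebra.centerPiEquiv fun d : Fin 2 => CyclicAlgebra (casimirValue pp pm d) ⊗[ℂ]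
      CyclicAlgebra (casimirValue pm pp d)).trans <| (AlgEquiv.piCongrRight g).trans <|
    AlgEquiv.collectBlocks (by simpa using h1) (by simpa using h2) (by simpa using h3)
      (by simpa using h4) LocalB (LocalB ⊗[ℂ] LocalB)⟩
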